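/- arXiv:1808.01548 — 2 statements merged into one kernel-verified Lean document; each statement's English description precedes it below -/
import Mathlib

section
/- Let g(n,m) denote the maximum number of edges of a graph on n vertices in which all cycles have distinct lengths and every cycle length is a multiple of m. Then for every even integer m, liminf_{n→∞} (g(n,m) − n)/√(n/m) ≥ √(2.444). -/
open SimpleGraph Filter

/-- A graph has all cycles of distinct lengths. -/
def distinctCycleLengths {V : Type*} (G : SimpleGraph V) : Prop :=
  ∀ (u v : V) (w : G.Walk u u) (w' : G.Walk v v), w.IsCycle → w'.IsCycle →
    w.length = w'.length → {e | e ∈ w.edges} = {e | e ∈ w'.edges}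

/-- `g n m` is the maximum number of edges of a graph on `n` vertices in which all
cycles have distinct lengths and every cycle length is a multiple of `m`. -/
noncomputable def g (n m : ℕ) : ℕ :=
  sSup {e | ∃ G : SimpleGraph (Fin n), distinctCycleLengths G ∧
    (∀ (u : Fin n) (w : G.Walk u u), w.IsCycle → m ∣ w.length) ∧
    G.edgeSet.ncard = e}

namespace DC

section Sub
variable {W E : Type} (s t : E → W) (len : E → ℕ)

abbrev SV (W : Type) {E : Type} (len : E → ℕ) := W ⊕ (Σ e : E, Fin (len e - 1))

def pos (e : E) (j : ℕ) : SV W len :=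
  if j = 0 then Sum.inl (s e) else
  if h : j < len e ∧ j ≠ 0 then Sum.inr ⟨e, ⟨j - 1, by omega⟩⟩ else Sum.inl (t e)

def qe (q : Σ e : E, Fin (len e)) : Sym2 (SV W len) :=
  s(pos s t len q.1 q.2, pos s t len q.1 (q.2 + 1))

def subG : SimpleGraph (SV W len) := SimpleGraph.fromEdgeSet (Set.range (qe s t len))

def tag : SV W len → Option (E × ℕ)
  | Sum.inl _ => none
  | Sum.inr x => some (x.1, x.2 + 1)

theorem tag_pos (e : E) (j : ℕ) :
    tag len (pos s t len e j) = if 0 < j ∧ j < len e then some (e, j) else none := by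
  unfold pos
  split_ifs <;> (simp_all [tag]; try omega)

theorem tag_inr {x : SV W len} {e : E} {k : Fin (len e - 1)} :
    x = Sum.inr ⟨e, k⟩ ↔ tag len x = some (e, (k : ℕ) + 1) := by
  constructor
  · rintro rfl; rfl
  · rcases x with w | ⟨e', k'⟩
    · simp [tag]
    · simp only [tag, Option.some.injEq, Prod.mk.injEq]
      rintro ⟨rfl, h⟩
      congr 2
      ext; omega

theorem pos_ne (hlen : ∀ e, 3 ≤ len e) (e : E) (j : ℕ) (hj : j < len e) : pos s t len e j ≠ pos s t len e (j + 1) := by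
  intro h
  have h := congrArg (tag len) h
  have := hlen e
  rw [tag_pos, tag_pos] at h
  clear hlen
  grind

theorem qe_inj (hlen : ∀ e, 3 ≤ len e) : Function.Injective (qe s t len) := by
  rintro ⟨e, j, hj⟩ ⟨e', j', hj'⟩ h
  have h1 := hlen e
  have h2 := hlen e'
  have key : e = e' ∧ j = j' := by
    simp only [qe, Sym2.eq_iff] at h
    rcases h with ⟨h, h'⟩ | ⟨h, h'⟩ <;>
    · have h := congrArg (tag len) h
      have h' := congrArg (tag len) h'
      rw [tag_pos, tag_pos] at h h'
      clear hlen
      grind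
  obtain ⟨rfl, rfl⟩ := key
  rfl

theorem inr_mem_qe (hlen : ∀ e, 3 ≤ len e) (e : E) (k : Fin (len e - 1)) (q : Σ e : E, Fin (len e)) :
    (Sum.inr ⟨e, k⟩ : SV W len) ∈ qe s t len q ↔
      q.1 = e ∧ ((q.2 : ℕ) = k ∨ (q.2 : ℕ) = k + 1) := by
  obtain ⟨e', j, hj⟩ := q
  have h1 := hlen e
  have h2 := hlen e'
  obtain ⟨k, hk⟩ := k
  rw [qe, Sym2.mem_iff, eq_comm, @eq_comm _ _ (pos s t len _ (_ + 1)), tag_inr, tag_inr, tag_pos,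
    tag_pos]
  clear hlen
  simp only
  grind

theorem inl_mem_qe (hlen : ∀ e, 3 ≤ len e) (w : W) (q : Σ e : E, Fin (len e)) :
    (Sum.inl w : SV W len) ∈ qe s t len q ↔
      ((q.2 : ℕ) = 0 ∧ s q.1 = w) ∨ ((q.2 : ℕ) = len q.1 - 1 ∧ t q.1 = w) := by
  obtain ⟨e', j, hj⟩ := q
  have h2 := hlen e'
  rw [qe, Sym2.mem_iff]
  simp only [pos] at hj ⊢
  clear hlen
  split_ifs <;> simp <;> grind

theorem subG_edgeSet (hlen : ∀ e, 3 ≤ len e) : (subG s t len).edgeSet = Set.range (qe s t len) := by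
  rw [subG, SimpleGraph.edgeSet_fromEdgeSet]
  ext x
  simp only [Set.mem_sdiff, Set.mem_range]
  constructor
  · exact fun h => h.1
  · rintro ⟨q, rfl⟩
    refine ⟨⟨q, rfl⟩, ?_⟩
    simp only [qe, Sym2.diagSet, Set.mem_ofPred_eq, Sym2.mk_isDiag_iff]
    exact pos_ne s t len hlen _ _ q.2.2

end Sub
end DC

namespace DC
section Cyc
variable {W E : Type} [Fintype E] [DecidableEq W] [DecidableEq E]
  (s t : E → W) (len : E → ℕ)

theorem card_even_pair {α : Type*} [DecidableEq α] (Q : Finset α) (P : α → Prop) [DecidablePred P]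
    (a b : α) (hab : a ≠ b)
    (hP : ∀ q, P q ↔ q = a ∨ q = b) (he : Even (Q.filter P).card) : a ∈ Q ↔ b ∈ Q := by
  have : Q.filter P = Q.filter (fun q => q = a) ∪ Q.filter (fun q => q = b) := by
    ext q; simp [hP]; tauto
  rw [this, Finset.card_union_of_disjoint, Finset.filter_eq', Finset.filter_eq'] at he
  · split_ifs at he with h1 h2 h2 <;> simp_all
  · rw [Finset.disjoint_filter]; rintro x _ rfl; exact hab

theorem cyc_struct (hlen : ∀ e, 3 ≤ len e) (u : SV W len) (c : (subG s t len).Walk u u)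
    (hc : c.IsCycle) :
    ∃ S : Finset E, S.Nonempty ∧
      (∀ x, x ∈ c.edges ↔ ∃ q : Σ e : E, Fin (len e), q.1 ∈ S ∧ qe s t len q = x) ∧
      c.length = ∑ e ∈ S, len e ∧
      ∀ w : W, Even (∑ e ∈ S, ((if s e = w then 1 else 0) + (if t e = w then 1 else 0))) := by
  classical
  set Q : Finset (Σ e : E, Fin (len e)) := Finset.univ.filter (fun q => qe s t len q ∈ c.edges)
    with hQ
  have hmem : ∀ q, q ∈ Q ↔ qe s t len q ∈ c.edges := by intro q; simp [hQ]
  have hed : ∀ x ∈ c.edges, ∃ q ∈ Q, qe s t len q = x := by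
    intro x hx
    have := c.edges_subset_edgeSet hx
    rw [subG_edgeSet s t len hlen] at this
    obtain ⟨q, rfl⟩ := this
    exact ⟨q, (hmem q).2 hx, rfl⟩
  have hinj := qe_inj s t len hlen
  have himg : c.edges.toFinset = Q.image (qe s t len) := by
    ext x
    simp only [List.mem_toFinset, Finset.mem_image]
    exact ⟨hed x, by rintro ⟨q, hq, rfl⟩; exact (hmem q).1 hq⟩
  have hnd : c.edges.Nodup := hc.isTrail.edges_nodup
  have heven : ∀ v : SV W len, Even (Q.filter (fun q => v ∈ qe s t len q)).card := by
    intro v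
    have h1 := (hc.isTrail.even_countP_edges_iff v).2 (by simp)
    have h2 : c.edges.countP (fun e => v ∈ e) = (Q.filter (fun q => v ∈ qe s t len q)).card := by
      rw [List.countP_eq_length_filter, ← List.toFinset_card_of_nodup (hnd.filter _),
        List.toFinset_filter, himg, ← Finset.card_image_of_injective _ hinj]
      congr 1
      ext x
      simp only [Finset.mem_filter, Finset.mem_image, decide_eq_true_eq]
      constructor
      · rintro ⟨⟨q, hq, rfl⟩, hv⟩; exact ⟨q, ⟨hq, hv⟩, rfl⟩
      · rintro ⟨q, ⟨hq, hv⟩, rfl⟩; exact ⟨⟨q, hq, rfl⟩, hv⟩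
    rw [← h2]; exact h1
  have hpos : ∀ e, 0 < len e := fun e => by have := hlen e; omega
  have hstep : ∀ e (j : ℕ) (hj : j + 1 < len e),
      ((⟨e, ⟨j, by omega⟩⟩ : Σ e : E, Fin (len e)) ∈ Q ↔ (⟨e, ⟨j + 1, hj⟩⟩ : Σ e : E, Fin (len e)) ∈ Q) := by
    intro e j hj
    refine card_even_pair Q (fun q => (Sum.inr ⟨e, ⟨j, by omega⟩⟩ : SV W len) ∈ qe s t len q) _ _ ?_ ?_
      (heven _)
    · simp
    · rintro ⟨e', j', hj'⟩
      rw [inr_mem_qe s t len hlen]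
      constructor
      · rintro ⟨h, h2⟩
        simp only at h h2
        subst h
        rcases h2 with rfl | rfl
        · left; rfl
        · right; rfl
      · rintro (h | h) <;> cases h <;> simp
  set S : Finset E := Finset.univ.filter (fun e => (⟨e, ⟨0, hpos e⟩⟩ : Σ e : E, Fin (len e)) ∈ Q) with hS
  have hQS : ∀ e (j : ℕ) (hj : j < len e), (⟨e, ⟨j, hj⟩⟩ : Σ e : E, Fin (len e)) ∈ Q ↔ e ∈ S := by
    intro e j
    induction j with
    | zero => intro hj; simp [hS]
    | succ j ih => intro hj; rw [← hstep e j hj]; exact ih _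
  have hQS' : ∀ q : (Σ e : E, Fin (len e)), q ∈ Q ↔ q.1 ∈ S := fun q => hQS q.1 q.2 q.2.2
  have hQsig : Q = S.sigma (fun _ => Finset.univ) := by
    ext q; simp [hQS']
  refine ⟨S, ?_, ?_, ?_, ?_⟩
  · have : c.edges ≠ [] := by
      intro h
      have h3 := hc.three_le_length
      rw [← c.length_edges, h] at h3
      simp at h3
    obtain ⟨x, hx⟩ := List.exists_mem_of_ne_nil _ this
    obtain ⟨q, hq, _⟩ := hed x hx
    exact ⟨q.1, (hQS' q).1 hq⟩
  · intro x
    constructor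
    · intro hx
      obtain ⟨q, hq, h⟩ := hed x hx
      exact ⟨q, (hQS' q).1 hq, h⟩
    · rintro ⟨q, hq, rfl⟩
      exact (hmem q).1 ((hQS' q).2 hq)
  · rw [← c.length_edges, ← List.toFinset_card_of_nodup hnd, himg,
      Finset.card_image_of_injective _ hinj, hQsig, Finset.card_sigma]
    simp
  · intro w
    have h := heven (Sum.inl w)
    have h2 : Q.filter (fun q => (Sum.inl w : SV W len) ∈ qe s t len q) =
        S.sigma (fun e => Finset.univ.filter (fun j : Fin (len e) =>
          ((j : ℕ) = 0 ∧ s e = w) ∨ ((j : ℕ) = len e - 1 ∧ t e = w))) := by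
      ext q
      simp [hQS', inl_mem_qe s t len hlen]
    rw [h2, Finset.card_sigma] at h
    convert h using 2 with e he
    have h3 := hlen e
    rw [Finset.filter_or, Finset.card_union_of_disjoint]
    · congr 1
      · split_ifs with hs
        · symm; rw [Finset.card_eq_one]
          exact ⟨⟨0, hpos e⟩, by ext j; simp [Fin.ext_iff, hs]⟩
        · symm; simp [hs]
      · split_ifs with hs
        · symm; rw [Finset.card_eq_one]
          exact ⟨⟨len e - 1, by omega⟩, by ext j; simp [Fin.ext_iff, hs]⟩
        · symm; simp [hs]
    · rw [Finset.disjoint_filter]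
      rintro x _ ⟨h, _⟩ ⟨h', _⟩
      omega
end Cyc
end DC

namespace DC
section Glue
variable {Γ : Type} (nv ne : Γ → ℕ)
  (s t : ∀ γ, Fin (ne γ) → Option (Fin (nv γ)))
  (len : (Σ γ, Fin (ne γ)) → ℕ)

abbrev WG (nv : Γ → ℕ) := Option (Σ γ, Fin (nv γ))

def gl (s : ∀ γ, Fin (ne γ) → Option (Fin (nv γ))) (e : Σ γ, Fin (ne γ)) : WG nv :=
  (s e.1 e.2).map (fun v => ⟨e.1, v⟩)

def comp : SV (WG nv) len → Option Γ
  | Sum.inl none => none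
  | Sum.inl (some x) => some x.1
  | Sum.inr x => some x.1.1

abbrev hub : SV (WG nv) len := Sum.inl none

theorem comp_eq_none (x : SV (WG nv) len) : comp nv ne len x = none ↔ x = hub nv ne len := by
  rcases x with (_ | x) | x <;> simp [comp]

theorem comp_qe (q : Σ e : (Σ γ, Fin (ne γ)), Fin (len e)) (v : SV (WG nv) len)
    (hv : v ∈ qe (gl nv ne s) (gl nv ne t) len q) :
    v = hub nv ne len ∨ comp nv ne len v = some q.1.1 := by
  rw [qe, Sym2.mem_iff] at hv
  have : ∀ (e : Σ γ, Fin (ne γ)) j, pos (gl nv ne s) (gl nv ne t) len e j = hub nv ne len ∨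
      comp nv ne len (pos (gl nv ne s) (gl nv ne t) len e j) = some e.1 := by
    intro e j
    unfold pos
    split_ifs
    · rcases h : s e.1 e.2 with _ | v <;> simp [gl, h, comp]
    · simp [comp]
    · rcases h : t e.1 e.2 with _ | v <;> simp [gl, h, comp]
  rcases hv with rfl | rfl <;> exact this _ _

theorem edge_inG (hlen : ∀ e, 3 ≤ len e) {u v : SV (WG nv) len}
    (h : (subG (gl nv ne s) (gl nv ne t) len).Adj u v) :
    ∃ q, qe (gl nv ne s) (gl nv ne t) len q = s(u, v) := by
  rw [← SimpleGraph.mem_edgeSet, subG_edgeSet _ _ _ hlen] at h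
  exact h

theorem walk_conf (hlen : ∀ e, 3 ≤ len e) {u v : SV (WG nv) len}
    (p : (subG (gl nv ne s) (gl nv ne t) len).Walk u v) (γ : Γ)
    (hu : comp nv ne len u = some γ) (hp : hub nv ne len ∉ p.support.dropLast) :
    ∀ q, qe (gl nv ne s) (gl nv ne t) len q ∈ p.edges → q.1.1 = γ := by
  have hinj := qe_inj (gl nv ne s) (gl nv ne t) len hlen
  induction p with
  | nil => simp
  | @cons u x v h p ih =>
    intro q hq
    obtain ⟨q0, hq0⟩ := edge_inG nv ne s t len hlen h
    have hu0 : q0.1.1 = γ := by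
      rcases comp_qe nv ne s t len q0 u (by rw [hq0]; simp) with h1 | h1
      · rw [h1] at hu; simp [comp] at hu
      · rw [hu] at h1; simpa using h1.symm
    rw [SimpleGraph.Walk.edges_cons, List.mem_cons] at hq
    rw [SimpleGraph.Walk.support_cons, List.dropLast_cons_of_ne_nil (by simp)] at hp
    rcases hq with hq | hq
    · rw [← hq0] at hq
      rw [hinj hq]; exact hu0
    · cases p with
      | nil => simp at hq
      | @cons _ y _ h' p' =>
        refine ih ?_ ?_ q hq
        · rcases comp_qe nv ne s t len q0 x (by rw [hq0]; simp) with h1 | h1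
          · exfalso; apply hp
            rw [SimpleGraph.Walk.support_cons, List.dropLast_cons_of_ne_nil (by simp), h1]
            simp
          · rw [h1, hu0]
        · intro h1; exact hp (List.mem_cons_of_mem _ h1)

theorem cyc_conf [DecidableEq Γ] (hlen : ∀ e, 3 ≤ len e) {u : SV (WG nv) len}
    (c : (subG (gl nv ne s) (gl nv ne t) len).Walk u u) (hc : c.IsCycle) :
    ∃ γ, ∀ q, qe (gl nv ne s) (gl nv ne t) len q ∈ c.edges → q.1.1 = γ := by
  have hinj := qe_inj (gl nv ne s) (gl nv ne t) len hlen
  by_cases hh : hub nv ne len ∈ c.support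
  · have hc' := hc.rotate hh
    have hr := SimpleGraph.Walk.rotate_edges c _ hh
    have hm : ∀ x, x ∈ c.edges ↔ x ∈ (c.rotate _ hh).edges := fun x => hr.mem_iff.symm
    generalize c.rotate _ hh = c' at hc' hm
    cases c' with
    | nil => simp at hc'
    | @cons _ x _ h p =>
      rw [SimpleGraph.Walk.cons_isCycle_iff] at hc'
      obtain ⟨q0, hq0⟩ := edge_inG nv ne s t len hlen h
      have hx : comp nv ne len x = some q0.1.1 := by
        rcases comp_qe nv ne s t len q0 x (by rw [hq0]; simp) with h1 | h1
        · exact absurd h1.symm h.ne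
        · exact h1
      refine ⟨q0.1.1, fun q hq => ?_⟩
      rw [hm, SimpleGraph.Walk.edges_cons, List.mem_cons] at hq
      rcases hq with hq | hq
      · rw [← hq0] at hq; rw [hinj hq]
      · refine walk_conf nv ne s t len hlen p _ hx ?_ q hq
        have hnd := hc'.1.support_nodup
        intro hmem
        rw [← List.dropLast_append_getLast (SimpleGraph.Walk.support_ne_nil p),
          SimpleGraph.Walk.getLast_support, List.nodup_append] at hnd
        exact hnd.2.2 _ hmem _ (by simp) rfl
  · have hu : comp nv ne len u ≠ none := by
      rw [Ne, comp_eq_none]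
      rintro rfl
      exact hh (by simp)
    obtain ⟨γ, hγ⟩ := Option.ne_none_iff_exists'.1 hu
    exact ⟨γ, walk_conf nv ne s t len hlen c γ hγ (fun h => hh (List.mem_of_mem_dropLast h))⟩

theorem cyc_glue [Fintype Γ] [DecidableEq Γ] (hlen : ∀ e, 3 ≤ len e) {u : SV (WG nv) len}
    (c : (subG (gl nv ne s) (gl nv ne t) len).Walk u u) (hc : c.IsCycle) :
    ∃ γ, ∃ T : Finset (Fin (ne γ)), T.Nonempty ∧
      (∀ x, x ∈ c.edges ↔ ∃ e ∈ T, ∃ j, qe (gl nv ne s) (gl nv ne t) len ⟨⟨γ, e⟩, j⟩ = x) ∧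
      c.length = ∑ e ∈ T, len ⟨γ, e⟩ ∧
      ∀ w : Option (Fin (nv γ)),
        Even (∑ e ∈ T, ((if s γ e = w then 1 else 0) + (if t γ e = w then 1 else 0))) := by
  obtain ⟨γ, hγ⟩ := cyc_conf nv ne s t len hlen c hc
  obtain ⟨S, hS, hed, hl, hev⟩ := cyc_struct _ _ len hlen u c hc
  have hSγ : ∀ e ∈ S, e.1 = γ := by
    intro e he
    have h3 := hlen e
    exact hγ ⟨e, ⟨0, by omega⟩⟩ ((hed _).2 ⟨_, he, rfl⟩)
  set T : Finset (Fin (ne γ)) := Finset.univ.filter (fun e => (⟨γ, e⟩ : Σ γ, Fin (ne γ)) ∈ S) with hT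
  have hST : S = T.map ⟨fun e => (⟨γ, e⟩ : Σ γ, Fin (ne γ)), fun a b h => by simpa using h⟩ := by
    ext ⟨γ', e⟩
    simp only [Finset.mem_map, hT, Finset.mem_filter,
      Finset.mem_univ, true_and]
    constructor
    · intro h
      obtain rfl := hSγ _ h
      exact ⟨e, h, rfl⟩
    · rintro ⟨e', h, h'⟩
      rwa [← h']
  refine ⟨γ, T, ?_, ?_, ?_, ?_⟩
  · rw [hST] at hS; simpa using hS
  · intro x
    rw [hed]
    constructor
    · rintro ⟨⟨⟨γ', e⟩, j⟩, h, rfl⟩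
      obtain rfl := hSγ _ h
      exact ⟨e, by simpa [hT] using h, j, rfl⟩
    · rintro ⟨e, he, j, rfl⟩
      exact ⟨_, by simpa [hT] using he, rfl⟩
  · rw [hl, hST, Finset.sum_map]; rfl
  · intro w
    have h := hev (w.map (fun v => ⟨γ, v⟩))
    rw [hST, Finset.sum_map] at h
    have hinj : Function.Injective (Option.map (fun v : Fin (nv γ) => (⟨γ, v⟩ : Σ γ, Fin (nv γ)))) :=
      Option.map_injective (fun a b h => by simpa using h)
    change Even (∑ e ∈ T, ((if Option.map (fun v => (⟨γ, v⟩ : Σ γ, Fin (nv γ))) (s γ e) =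
        w.map (fun v => ⟨γ, v⟩) then 1 else 0) +
      (if Option.map (fun v => (⟨γ, v⟩ : Σ γ, Fin (nv γ))) (t γ e) =
        w.map (fun v => ⟨γ, v⟩) then 1 else 0))) at h
    simpa only [hinj.eq_iff] using h

end Glue
end DC

namespace DC

theorem g_bdd (n m : ℕ) : BddAbove {e | ∃ G : SimpleGraph (Fin n), distinctCycleLengths G ∧
    (∀ (u : Fin n) (w : G.Walk u u), w.IsCycle → m ∣ w.length) ∧
    G.edgeSet.ncard = e} := by
  refine ⟨Nat.card (Sym2 (Fin n)), ?_⟩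
  rintro e ⟨G, _, _, rfl⟩
  exact Set.ncard_le_card _

theorem g_ge_of_graph {V : Type} [Fintype V] (G : SimpleGraph V) (m : ℕ)
    (hd : distinctCycleLengths G) (hm : ∀ (u : V) (w : G.Walk u u), w.IsCycle → m ∣ w.length) :
    G.edgeSet.ncard ≤ g (Fintype.card V) m := by
  classical
  let f := Fintype.equivFin V
  let G' := G.map f.toEmbedding
  let I : G ≃g G' := SimpleGraph.Iso.map f G
  let J : G' →g G := I.symm.toHom
  have hJ : Function.Injective J := I.symm.injective
  refine le_csSup (g_bdd _ _) ⟨G', ?_, ?_, ?_⟩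
  · intro u v w w' hw hw' hl
    have h := hd _ _ (w.map J) (w'.map J) (hw.map hJ) (hw'.map hJ) (by simpa using hl)
    ext x
    have h2 := Set.ext_iff.1 h (Sym2.map J x)
    have hs := Sym2.map.injective hJ
    simpa only [Set.mem_ofPred_eq, SimpleGraph.Walk.edges_map, List.mem_map_of_injective hs] using h2
  · intro u w hw
    have := hm _ (w.map J) (hw.map hJ)
    simpa using this
  · exact (Nat.card_congr I.mapEdgeSet).symm

section
variable {Γ : Type} [Fintype Γ] [DecidableEq Γ] (nv ne : Γ → ℕ)
  (s t : ∀ γ, Fin (ne γ) → Option (Fin (nv γ)))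
  (len : (Σ γ, Fin (ne γ)) → ℕ)

def EvenAt {a b : ℕ} (s t : Fin a → Option (Fin b)) (T : Finset (Fin a)) : Prop :=
  ∀ w : Option (Fin b),
    Even (∑ e ∈ T, ((if s e = w then 1 else 0) + (if t e = w then 1 else 0)))

theorem g_ge_glue (m : ℕ) (hlen : ∀ e, 3 ≤ len e)
    (hdvd : ∀ γ (T : Finset (Fin (ne γ))), T.Nonempty → EvenAt (s γ) (t γ) T →
      m ∣ ∑ e ∈ T, len ⟨γ, e⟩)
    (hdist : ∀ γ (T : Finset (Fin (ne γ))) γ' (T' : Finset (Fin (ne γ'))),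
      T.Nonempty → EvenAt (s γ) (t γ) T → T'.Nonempty → EvenAt (s γ') (t γ') T' →
      ∑ e ∈ T, len ⟨γ, e⟩ = ∑ e ∈ T', len ⟨γ', e⟩ →
      (⟨γ, T⟩ : Σ γ, Finset (Fin (ne γ))) = ⟨γ', T'⟩) :
    ∑ e, len e ≤ g (1 + ∑ γ, nv γ + ∑ e, (len e - 1)) m := by
  have h := g_ge_of_graph (subG (gl nv ne s) (gl nv ne t) len) m ?_ ?_
  · have hc : Fintype.card (SV (WG nv) len) = 1 + ∑ γ, nv γ + ∑ e, (len e - 1) := by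
      simp [SV, WG]; ring
    rw [hc] at h
    refine le_trans (le_of_eq ?_) h
    rw [subG_edgeSet _ _ _ hlen, ← Set.image_univ,
      Set.ncard_image_of_injective _ (qe_inj _ _ _ hlen), Set.ncard_univ]
    simp
  · intro u v w w' hw hw' hl
    obtain ⟨γ, T, hT, hed, hln, hev⟩ := cyc_glue nv ne s t len hlen w hw
    obtain ⟨γ', T', hT', hed', hln', hev'⟩ := cyc_glue nv ne s t len hlen w' hw'
    have := hdist γ T γ' T' hT hev hT' hev' (by rw [← hln, ← hln', hl])
    cases this
    ext x
    exact (hed x).trans (hed' x).symm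
  · intro u w hw
    obtain ⟨γ, T, hT, hed, hln, hev⟩ := cyc_glue nv ne s t len hlen w hw
    rw [hln]; exact hdvd γ T hT hev

theorem pend_not_even (T : Finset (Fin 1)) (hT : T.Nonempty) :
    ¬ EvenAt (fun _ : Fin 1 => (none : Option (Fin 1))) (fun _ => some 0) T := by
  intro h
  have h1 := h (some 0)
  have h2 : T = {0} := by
    obtain ⟨x, hx⟩ := hT
    ext y
    have hxy : y = x := Subsingleton.elim _ _
    have hy0 : y = 0 := Subsingleton.elim _ _
    simp only [Finset.mem_singleton]
    exact ⟨fun _ => hy0, fun _ => by rw [hxy]; exact hx⟩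
  rw [h2] at h1
  simp at h1

/-- with a pendant path filling up to `n` vertices -/
theorem g_ge_pend (m n : ℕ) (hlen : ∀ e, 3 ≤ len e)
    (hdvd : ∀ γ (T : Finset (Fin (ne γ))), T.Nonempty → EvenAt (s γ) (t γ) T →
      m ∣ ∑ e ∈ T, len ⟨γ, e⟩)
    (hdist : ∀ γ (T : Finset (Fin (ne γ))) γ' (T' : Finset (Fin (ne γ'))),
      T.Nonempty → EvenAt (s γ) (t γ) T → T'.Nonempty → EvenAt (s γ') (t γ') T' →
      ∑ e ∈ T, len ⟨γ, e⟩ = ∑ e ∈ T', len ⟨γ', e⟩ →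
      (⟨γ, T⟩ : Σ γ, Finset (Fin (ne γ))) = ⟨γ', T'⟩)
    (hn : 4 + ∑ γ, nv γ + ∑ e, (len e - 1) ≤ n) :
    n + ∑ γ, ne γ ≤ g n m + 1 + ∑ γ, nv γ := by
  obtain ⟨L, hL⟩ := Nat.exists_eq_add_of_le hn
  have hE : ∑ e, len e = ∑ e, (len e - 1) + ∑ γ, ne γ := by
    have : ∑ γ, ne γ = ∑ e : (Σ γ, Fin (ne γ)), 1 := by simp
    rw [this, ← Finset.sum_add_distrib]
    exact Finset.sum_congr rfl (fun e _ => by have := hlen e; omega)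
  let nv' : Option Γ → ℕ := fun o => o.elim 1 nv
  let ne' : Option Γ → ℕ := fun o => o.elim 1 ne
  let s' : ∀ γ, Fin (ne' γ) → Option (Fin (nv' γ)) := fun o => match o with
    | none => fun _ => none
    | some γ => s γ
  let t' : ∀ γ, Fin (ne' γ) → Option (Fin (nv' γ)) := fun o => match o with
    | none => fun _ => some (0 : Fin 1)
    | some γ => t γ
  let len' : (Σ γ, Fin (ne' γ)) → ℕ := fun e => match e with
    | ⟨none, _⟩ => L + 3
    | ⟨some γ, e⟩ => len ⟨γ, e⟩
  have hnone : ∀ T : Finset (Fin (ne' none)), T.Nonempty → ¬ EvenAt (s' none) (t' none) T := by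
    exact pend_not_even
  have key := g_ge_glue nv' ne' s' t' len' m ?_ ?_ ?_
  · have e1 : ∑ γ, nv' γ = 1 + ∑ γ, nv γ := by rw [Fintype.sum_option]; rfl
    have gen : ∀ F : ℕ → ℕ, ∑ e, F (len' e) = F (L + 3) + ∑ e, F (len e) := by
      intro F
      rw [Fintype.sum_sigma, Fintype.sum_option, Fintype.sum_sigma]
      congr 1
    have e2 := gen (fun x => x)
    have e3 := gen (fun x => x - 1)
    rw [e1, e2, e3] at key
    have hn' : 1 + (1 + ∑ γ, nv γ) + (L + 3 - 1 + ∑ e, (len e - 1)) = n := by omega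
    rw [hn'] at key
    omega
  · rintro ⟨_ | γ, e⟩
    · change 3 ≤ L + 3; omega
    · exact hlen ⟨γ, e⟩
  · rintro (_ | γ) T hT hev
    · exact absurd hev (hnone T hT)
    · exact hdvd γ T hT hev
  · rintro (_ | γ) T (_ | γ') T' hT hev hT' hev' h
    · exact absurd hev (hnone T hT)
    · exact absurd hev (hnone T hT)
    · exact absurd hev' (hnone T' hT')
    · have := hdist γ T γ' T' hT hev hT' hev' h
      cases this
      rfl
end
end DC

namespace DC

/-- An edge of a gadget: end vertices (0 is the hub), growth parameters, offsets. -/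
structure Ed where
  (a b P Q c D : ℕ)

/-- A family of gadgets: number of non-hub vertices, edges. -/
structure Fam where
  (nv : ℕ)
  (es : List Ed)

def bigFams : List Fam := [
  ⟨7, [⟨2, 3, 6, 6, 0, 0⟩,
    ⟨3, 4, 6, 5, 1, 0⟩,
    ⟨3, 7, 4, 3, 1, 38058320229944888328⟩,
    ⟨4, 5, 6, 5, 2, 0⟩,
    ⟨0, 4, 3, 3, 3, 100825499031566632433⟩,
    ⟨6, 7, 8, 8, 1, 0⟩,
    ⟨7, 0, 7, 7, 3, 82345814753340454536⟩,
    ⟨0, 1, 6, 5, 0, 0⟩,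
    ⟨1, 2, 5, 5, 0, 0⟩,
    ⟨1, 5, 5, 5, 1, 11751294212449214314⟩,
    ⟨2, 6, 8, 7, 0, 46844596840704135728⟩,
    ⟨5, 6, 4, 3, 1, 0⟩]⟩,
  ⟨7, [⟨5, 6, 6, 6, 1, 0⟩,
    ⟨6, 7, 8, 8, 2, 0⟩,
    ⟨2, 6, 5, 6, 1, 54398436378778140414⟩,
    ⟨4, 5, 6, 7, 1, 0⟩,
    ⟨1, 5, 3, 4, 0, 57449220837799040617⟩,
    ⟨0, 1, 6, 6, 1, 0⟩,
    ⟨1, 2, 6, 6, 0, 0⟩,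
    ⟨2, 3, 6, 7, 1, 0⟩,
    ⟨3, 4, 5, 6, 0, 0⟩,
    ⟨0, 4, 5, 5, 0, 56094770780484999294⟩,
    ⟨3, 7, 7, 7, 0, 12883465723486847419⟩,
    ⟨7, 0, 3, 4, 2, 66680986360109148487⟩]⟩,
  ⟨3, [⟨0, 3, 6, 6, 0, 0⟩,
    ⟨1, 3, 7, 7, 3, 53816049224986322573⟩,
    ⟨2, 3, 5, 7, 1, 95919777745667277961⟩,
    ⟨0, 2, 5, 7, 3, 0⟩,
    ⟨1, 2, 8, 4, 0, 24155796516602304278⟩,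
    ⟨0, 1, 7, 5, 3, 0⟩]⟩,
  ⟨3, [⟨0, 3, 7, 9, 3, 0⟩,
    ⟨1, 3, 6, 6, 1, 86201748732434335870⟩,
    ⟨2, 3, 6, 5, 2, 88822862332235365359⟩,
    ⟨0, 1, 7, 3, 2, 0⟩,
    ⟨1, 2, 6, 5, 1, 18466358871745931489⟩,
    ⟨0, 2, 5, 8, 3, 0⟩]⟩,
  ⟨3, [⟨0, 2, 7, 6, 2, 0⟩,
    ⟨1, 2, 6, 5, 1, 5610553953828700885⟩,
    ⟨2, 3, 4, 2, 1, 83350213093515775380⟩,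
    ⟨0, 1, 7, 7, 1, 0⟩,
    ⟨0, 3, 7, 6, 3, 0⟩,
    ⟨1, 3, 6, 5, 0, 17110665639963493143⟩]⟩,
  ⟨3, [⟨0, 1, 5, 9, 3, 0⟩,
    ⟨1, 2, 4, 5, 2, 18072879317559446246⟩,
    ⟨1, 3, 6, 7, 0, 24756444691353533356⟩,
    ⟨0, 2, 7, 4, 1, 0⟩,
    ⟨2, 3, 6, 6, 2, 43360086948888000149⟩,
    ⟨0, 3, 7, 6, 3, 0⟩]⟩,
  ⟨7, [⟨0, 1, 5, 5, 2, 0⟩,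
    ⟨1, 2, 8, 9, 1, 0⟩,
    ⟨1, 5, 6, 6, 2, 62905505809929229904⟩,
    ⟨7, 0, 8, 9, 0, 92632555029549855893⟩,
    ⟨0, 4, 5, 6, 1, 9042244716697100332⟩,
    ⟨4, 5, 6, 7, 3, 0⟩,
    ⟨5, 6, 5, 5, 2, 0⟩,
    ⟨3, 4, 7, 7, 0, 0⟩,
    ⟨6, 7, 4, 5, 2, 0⟩,
    ⟨2, 6, 3, 4, 3, 21846767778730103781⟩,
    ⟨2, 3, 5, 5, 2, 0⟩,
    ⟨3, 7, 4, 4, 3, 26673220022829741385⟩]⟩,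
  ⟨7, [⟨2, 3, 6, 6, 3, 0⟩,
    ⟨3, 4, 8, 8, 1, 0⟩,
    ⟨3, 7, 4, 5, 3, 86821218536617055623⟩,
    ⟨6, 7, 6, 6, 3, 0⟩,
    ⟨7, 0, 5, 5, 3, 66112298182469939158⟩,
    ⟨1, 2, 5, 6, 1, 0⟩,
    ⟨2, 6, 4, 5, 1, 10348960237491710305⟩,
    ⟨5, 6, 5, 6, 3, 0⟩,
    ⟨0, 1, 8, 8, 2, 0⟩,
    ⟨1, 5, 6, 7, 1, 27599151698903260466⟩,
    ⟨4, 5, 7, 7, 2, 0⟩,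
    ⟨0, 4, 5, 6, 3, 23357050089229470964⟩]⟩,
  ⟨3, [⟨0, 3, 5, 11, 3, 0⟩,
    ⟨1, 3, 4, 3, 1, 54720543293987488019⟩,
    ⟨2, 3, 10, 9, 1, 2327799319454925432⟩,
    ⟨0, 1, 7, 6, 0, 0⟩,
    ⟨1, 2, 6, 6, 2, 22071184627270683175⟩,
    ⟨0, 2, 7, 6, 0, 0⟩]⟩,
  ⟨7, [⟨5, 6, 8, 8, 1, 0⟩,
    ⟨6, 7, 6, 6, 0, 0⟩,
    ⟨2, 6, 3, 4, 0, 72131795121609581229⟩,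
    ⟨7, 0, 6, 7, 3, 84361566049103284201⟩,
    ⟨3, 7, 7, 7, 3, 61969666709227263110⟩,
    ⟨2, 3, 4, 5, 3, 0⟩,
    ⟨3, 4, 3, 4, 2, 0⟩,
    ⟨1, 2, 4, 4, 2, 0⟩,
    ⟨4, 5, 8, 9, 2, 0⟩,
    ⟨0, 4, 6, 6, 0, 60000355974578408639⟩,
    ⟨0, 1, 5, 5, 3, 0⟩,
    ⟨1, 5, 5, 6, 3, 40436754705684339542⟩]⟩,
  ⟨7, [⟨3, 4, 6, 6, 1, 0⟩,
    ⟨4, 5, 7, 7, 3, 0⟩,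
    ⟨0, 4, 6, 7, 3, 23637093057459765988⟩,
    ⟨0, 1, 4, 5, 3, 0⟩,
    ⟨7, 0, 8, 8, 0, 87064208925285588863⟩,
    ⟨5, 6, 6, 7, 1, 0⟩,
    ⟨1, 5, 5, 5, 1, 41684495415690321371⟩,
    ⟨1, 2, 8, 9, 0, 0⟩,
    ⟨6, 7, 3, 3, 1, 0⟩,
    ⟨2, 6, 3, 3, 0, 4178413606453132379⟩,
    ⟨2, 3, 6, 7, 3, 0⟩,
    ⟨3, 7, 4, 5, 0, 79978686554887545691⟩]⟩,
  ⟨3, [⟨0, 1, 9, 8, 3, 0⟩,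
    ⟨1, 2, 4, 5, 3, 81492780120907156013⟩,
    ⟨1, 3, 7, 8, 0, 39258838458719619217⟩,
    ⟨0, 2, 7, 5, 2, 0⟩,
    ⟨0, 3, 2, 6, 3, 0⟩,
    ⟨2, 3, 7, 7, 1, 54430684419060952636⟩]⟩,
  ⟨7, [⟨4, 5, 4, 5, 2, 0⟩,
    ⟨5, 6, 6, 7, 1, 0⟩,
    ⟨1, 5, 5, 5, 2, 54685761619389625498⟩,
    ⟨6, 7, 3, 4, 0, 0⟩,
    ⟨2, 6, 5, 5, 1, 14686084975315645866⟩,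
    ⟨1, 2, 6, 7, 2, 0⟩,
    ⟨2, 3, 6, 6, 3, 0⟩,
    ⟨0, 1, 5, 5, 0, 0⟩,
    ⟨7, 0, 7, 7, 3, 21979427057284344972⟩,
    ⟨0, 4, 6, 7, 0, 74260447613821053141⟩,
    ⟨3, 4, 5, 5, 1, 0⟩,
    ⟨3, 7, 6, 7, 0, 21577205083563508094⟩]⟩,
  ⟨7, [⟨1, 5, 5, 5, 2, 0⟩,
    ⟨4, 5, 7, 6, 3, 38166117185938067683⟩,
    ⟨5, 7, 5, 5, 2, 65617437064771087283⟩,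
    ⟨0, 4, 8, 7, 0, 0⟩,
    ⟨4, 6, 6, 6, 1, 44646988025991952699⟩,
    ⟨3, 7, 7, 6, 0, 0⟩,
    ⟨6, 7, 6, 5, 2, 61376661128682789551⟩,
    ⟨2, 6, 5, 5, 1, 0⟩,
    ⟨0, 1, 4, 4, 1, 0⟩,
    ⟨0, 2, 7, 6, 0, 0⟩,
    ⟨1, 3, 7, 6, 2, 0⟩,
    ⟨2, 3, 4, 4, 3, 85367058950840574645⟩]⟩,
  ⟨3, [⟨0, 1, 7, 8, 0, 0⟩,
    ⟨1, 2, 3, 6, 0, 82886826407650006860⟩,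
    ⟨1, 3, 8, 9, 1, 49694538718756181091⟩,
    ⟨0, 3, 5, 5, 1, 0⟩,
    ⟨2, 3, 7, 5, 3, 82344909839167605695⟩,
    ⟨0, 2, 8, 6, 2, 0⟩]⟩,
  ⟨7, [⟨6, 7, 5, 5, 1, 0⟩,
    ⟨7, 0, 6, 7, 3, 25051409039697693394⟩,
    ⟨3, 7, 3, 4, 0, 83887781211046157312⟩,
    ⟨0, 1, 2, 2, 0, 0⟩,
    ⟨0, 4, 7, 7, 1, 30367338460788243848⟩,
    ⟨3, 4, 4, 4, 0, 0⟩,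
    ⟨4, 5, 8, 9, 0, 0⟩,
    ⟨2, 3, 8, 9, 1, 0⟩,
    ⟨1, 2, 7, 8, 0, 0⟩,
    ⟨2, 6, 8, 8, 0, 92413722714887415888⟩,
    ⟨5, 6, 4, 4, 3, 0⟩,
    ⟨1, 5, 5, 6, 3, 79607298093176935652⟩]⟩,
  ⟨3, [⟨0, 1, 3, 6, 2, 0⟩,
    ⟨1, 2, 7, 3, 1, 14985682181475718662⟩,
    ⟨1, 3, 7, 6, 3, 43750231975869926510⟩,
    ⟨0, 2, 8, 7, 1, 0⟩,
    ⟨2, 3, 2, 3, 0, 667105501004214599⟩,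
    ⟨0, 3, 8, 10, 1, 0⟩]⟩,
  ⟨7, [⟨0, 1, 6, 6, 1, 0⟩,
    ⟨1, 2, 5, 5, 2, 0⟩,
    ⟨1, 5, 6, 7, 2, 80675555884205797548⟩,
    ⟨4, 5, 5, 5, 2, 0⟩,
    ⟨5, 6, 5, 6, 2, 0⟩,
    ⟨6, 7, 5, 6, 0, 0⟩,
    ⟨2, 6, 4, 4, 0, 26027874823907362349⟩,
    ⟨2, 3, 5, 6, 0, 0⟩,
    ⟨3, 4, 5, 5, 2, 0⟩,
    ⟨3, 7, 8, 8, 0, 14510231056553881778⟩,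
    ⟨0, 4, 9, 10, 3, 18663589020063025158⟩,
    ⟨7, 0, 4, 5, 3, 1342083058164172146⟩]⟩,
  ⟨7, [⟨4, 5, 4, 4, 3, 0⟩,
    ⟨5, 6, 6, 7, 1, 0⟩,
    ⟨1, 5, 3, 4, 2, 42936743226230390666⟩,
    ⟨0, 1, 9, 9, 1, 0⟩,
    ⟨1, 2, 6, 7, 0, 0⟩,
    ⟨2, 3, 7, 7, 2, 0⟩,
    ⟨2, 6, 5, 6, 3, 75626172492376100058⟩,
    ⟨6, 7, 7, 7, 0, 0⟩,
    ⟨7, 0, 5, 5, 2, 99684661265866197559⟩,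
    ⟨0, 4, 6, 7, 2, 48738886191237518698⟩,
    ⟨3, 4, 4, 4, 3, 0⟩,
    ⟨3, 7, 3, 4, 1, 76388263944228107676⟩]⟩,
  ⟨7, [⟨2, 3, 5, 5, 0, 0⟩,
    ⟨3, 4, 7, 7, 1, 0⟩,
    ⟨3, 7, 7, 8, 1, 56129866981341169983⟩,
    ⟨6, 7, 8, 8, 1, 0⟩,
    ⟨7, 0, 5, 5, 3, 18184615358825110524⟩,
    ⟨1, 2, 4, 5, 1, 0⟩,
    ⟨2, 6, 4, 5, 0, 51047874690172988455⟩,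
    ⟨5, 6, 4, 5, 0, 0⟩,
    ⟨0, 1, 5, 5, 3, 0⟩,
    ⟨0, 4, 3, 4, 3, 90670007254051723439⟩,
    ⟨1, 5, 4, 5, 3, 46091368077453260283⟩,
    ⟨4, 5, 10, 10, 1, 0⟩]⟩,
  ⟨7, [⟨0, 1, 6, 6, 2, 0⟩,
    ⟨7, 0, 2, 3, 1, 54219746183664231272⟩,
    ⟨0, 4, 7, 7, 3, 67673281020932294645⟩,
    ⟨1, 2, 3, 3, 2, 0⟩,
    ⟨1, 5, 7, 8, 3, 87064273603759340529⟩,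
    ⟨4, 5, 6, 7, 0, 0⟩,
    ⟨5, 6, 5, 5, 0, 0⟩,
    ⟨3, 4, 7, 8, 3, 0⟩,
    ⟨2, 3, 7, 8, 2, 0⟩,
    ⟨2, 6, 3, 4, 1, 67003640019675293607⟩,
    ⟨6, 7, 8, 8, 2, 0⟩,
    ⟨3, 7, 4, 4, 1, 51939537076788088782⟩]⟩,
  ⟨3, [⟨0, 3, 4, 7, 1, 0⟩,
    ⟨1, 3, 11, 7, 0, 85433896409398017302⟩,
    ⟨2, 3, 5, 6, 2, 89045232235621155856⟩,
    ⟨0, 1, 7, 6, 1, 0⟩,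
    ⟨1, 2, 4, 3, 0, 19751031708544405772⟩,
    ⟨0, 2, 7, 7, 3, 0⟩]⟩,
  ⟨3, [⟨0, 2, 8, 8, 2, 0⟩,
    ⟨1, 2, 9, 8, 3, 81596007284988749646⟩,
    ⟨2, 3, 2, 5, 1, 77760272396224347833⟩,
    ⟨0, 1, 5, 4, 1, 0⟩,
    ⟨0, 3, 4, 5, 1, 0⟩,
    ⟨1, 3, 11, 7, 2, 92865228953491596551⟩]⟩,
  ⟨3, [⟨0, 1, 9, 6, 2, 0⟩,
    ⟨1, 2, 4, 8, 2, 25863831523130793038⟩,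
    ⟨1, 3, 9, 7, 0, 15538804856382656544⟩,
    ⟨0, 3, 4, 5, 2, 0⟩,
    ⟨2, 3, 7, 7, 2, 95766508053683909036⟩,
    ⟨0, 2, 7, 8, 2, 0⟩]⟩,
  ⟨3, [⟨0, 1, 9, 7, 2, 0⟩,
    ⟨1, 2, 8, 4, 0, 79280988934117710329⟩,
    ⟨1, 3, 4, 4, 0, 29804419087753161576⟩,
    ⟨0, 2, 3, 5, 2, 0⟩,
    ⟨2, 3, 8, 10, 2, 25081875313872403096⟩,
    ⟨0, 3, 7, 7, 0, 0⟩]⟩,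
  ⟨3, [⟨0, 1, 4, 5, 0, 0⟩,
    ⟨1, 2, 6, 7, 2, 74065880937926898951⟩,
    ⟨1, 3, 8, 6, 2, 86863157434139029055⟩,
    ⟨0, 2, 8, 8, 0, 0⟩,
    ⟨2, 3, 4, 3, 2, 39867862457111419461⟩,
    ⟨0, 3, 6, 9, 0, 0⟩]⟩,
  ⟨3, [⟨0, 1, 6, 5, 1, 0⟩,
    ⟨1, 2, 9, 6, 3, 22203880457548748260⟩,
    ⟨1, 3, 6, 4, 2, 73184400237034187489⟩,
    ⟨0, 2, 3, 5, 2, 0⟩,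
    ⟨2, 3, 5, 8, 3, 53753539533667889137⟩,
    ⟨0, 3, 8, 7, 1, 0⟩]⟩,
  ⟨1, [⟨0, 1, 5, 6, 0, 98124921586131959963⟩, ⟨0, 1, 7, 8, 0, 25060858423394280070⟩, ⟨0, 1, 7, 8, 0, 0⟩]⟩,
  ⟨1, [⟨0, 1, 5, 6, 0, 18300576000615887494⟩, ⟨0, 1, 7, 8, 0, 26436581609154514197⟩, ⟨0, 1, 7, 8, 0, 0⟩]⟩,
  ⟨1, [⟨0, 1, 5, 6, 0, 98855812365077750506⟩, ⟨0, 1, 7, 8, 0, 97007107037814013882⟩, ⟨0, 1, 7, 8, 0, 0⟩]⟩,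
  ⟨1, [⟨0, 1, 5, 6, 0, 19031466779561678037⟩, ⟨0, 1, 7, 8, 0, 24771185441640555204⟩, ⟨0, 1, 7, 8, 0, 0⟩]⟩,
  ⟨1, [⟨0, 1, 5, 6, 0, 79824345585516072470⟩, ⟨0, 1, 7, 8, 0, 4363995476318643041⟩, ⟨0, 1, 7, 8, 0, 0⟩]⟩,
  ⟨1, [⟨0, 1, 5, 6, 0, 1⟩, ⟨0, 1, 7, 8, 0, 5739718662078877168⟩, ⟨0, 1, 7, 8, 0, 0⟩]⟩,
  ⟨1, [⟨0, 1, 6, 7, 0, 87943910697906793593⟩, ⟨0, 1, 6, 7, 0, 35889498859416697643⟩, ⟨0, 1, 8, 9, 0, 0⟩]⟩,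
  ⟨1, [⟨0, 1, 6, 7, 0, 8119565112390721124⟩, ⟨0, 1, 6, 7, 0, 60559932776358757402⟩, ⟨0, 1, 8, 9, 0, 0⟩]⟩,
  ⟨1, [⟨0, 1, 6, 7, 0, 88674801476852584136⟩, ⟨0, 1, 6, 7, 0, 19031466779561678037⟩, ⟨0, 1, 8, 9, 0, 0⟩]⟩,
  ⟨1, [⟨0, 1, 6, 7, 0, 8850455891336511667⟩, ⟨0, 1, 6, 7, 0, 30967827981059495765⟩, ⟨0, 1, 8, 9, 0, 0⟩]⟩,
  ⟨1, [⟨0, 1, 6, 7, 0, 69643334697290906100⟩, ⟨0, 1, 6, 7, 0, 1⟩, ⟨0, 1, 8, 9, 0, 0⟩]⟩,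
  ⟨1, [⟨0, 1, 5, 6, 0, 91357342521493829080⟩, ⟨0, 1, 7, 8, 0, 45051171456781355730⟩, ⟨0, 1, 9, 10, 0, 0⟩]⟩,
  ⟨1, [⟨0, 1, 5, 6, 0, 27557193298455267897⟩, ⟨0, 1, 7, 8, 0, 5696140159690934795⟩, ⟨0, 1, 9, 10, 0, 0⟩]⟩,
  ⟨1, [⟨0, 1, 5, 6, 0, 49271201122658190877⟩, ⟨0, 1, 7, 8, 0, 27776262444991499621⟩, ⟨0, 1, 9, 10, 0, 0⟩]⟩,
  ⟨1, [⟨0, 1, 5, 6, 0, 8525726518893589861⟩, ⟨0, 1, 7, 8, 0, 51813025550703548799⟩, ⟨0, 1, 9, 10, 0, 0⟩]⟩,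
  ⟨1, [⟨0, 1, 5, 6, 0, 30239734343096512841⟩, ⟨0, 1, 7, 8, 0, 44267494482991456785⟩, ⟨0, 1, 9, 10, 0, 0⟩]⟩,
  ⟨1, [⟨0, 1, 5, 6, 0, 9256617297839380404⟩, ⟨0, 1, 7, 8, 0, 40801962045317733492⟩, ⟨0, 1, 9, 10, 0, 0⟩]⟩,
  ⟨1, [⟨0, 1, 5, 6, 0, 30970625122042303384⟩, ⟨0, 1, 7, 8, 0, 88821846791413994259⟩, ⟨0, 1, 9, 10, 0, 0⟩]⟩,
  ⟨1, [⟨0, 1, 5, 6, 0, 91763503927996697817⟩, ⟨0, 1, 7, 8, 0, 11320256487407047988⟩, ⟨0, 1, 9, 10, 0, 0⟩]⟩,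
  ⟨1, [⟨0, 1, 5, 6, 0, 11939158342480625348⟩, ⟨0, 1, 7, 8, 0, 23570631535915819756⟩, ⟨0, 1, 9, 10, 0, 0⟩]⟩,
  ⟨1, [⟨0, 1, 5, 6, 0, 95036219134987846282⟩, ⟨0, 1, 7, 8, 0, 81222707276639412702⟩, ⟨0, 1, 9, 10, 0, 0⟩]⟩,
  ⟨1, [⟨0, 1, 5, 6, 0, 15211873549471773813⟩, ⟨0, 1, 7, 8, 0, 1764476152220982079⟩, ⟨0, 1, 9, 10, 0, 0⟩]⟩,
  ⟨1, [⟨0, 1, 5, 6, 0, 76004752355426168246⟩, ⟨0, 1, 7, 8, 0, 25801239257933031257⟩, ⟨0, 1, 9, 10, 0, 0⟩]⟩,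
  ⟨1, [⟨0, 1, 5, 6, 0, 97718760179629091226⟩, ⟨0, 1, 7, 8, 0, 48798740854896438353⟩, ⟨0, 1, 9, 10, 0, 0⟩]⟩,
  ⟨1, [⟨0, 1, 5, 6, 0, 76735643134371958789⟩, ⟨0, 1, 7, 8, 0, 45333208417222715060⟩, ⟨0, 1, 9, 10, 0, 0⟩]⟩]

/-- one representative for each of the 32 colours -/
def colReps : List ℕ := [5437024067749476180, 27151031891952399160, 87943910697906793593, 8119565112390721124, 88674801476852584136, 8850455891336511667, 69643334697290906100, 91357342521493829080, 27557193298455267897, 49271201122658190877, 8525726518893589861, 30239734343096512841, 9256617297839380404, 30970625122042303384, 91763503927996697817, 11939158342480625348, 95036219134987846282, 15211873549471773813, 76004752355426168246, 97718760179629091226, 76735643134371958789, 98449650958574881769, 57704176354810280753, 79418184179013203733, 15618034955974642550, 37332042780177565530, 98124921586131959963, 18300576000615887494, 98855812365077750506, 19031466779561678037, 79824345585516072470, 1]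

def plainFams : List Fam :=
  (List.range 6).flatMap fun l => colReps.map fun d => ⟨0, [⟨0, 0, 2 * l, 2 * l + 2, 0, d⟩]⟩

def fams : List Fam := bigFams ++ plainFams

def pr : Fin 5 → ℕ := ![10007, 10009, 10037, 10039, 10061]

structure Acc where
  (x mask P Q c d : ℕ)

def Acc.add (s : Acc) (e : Ed) (k : ℕ) : Acc :=
  ⟨s.x ^^^ (2 ^ e.a ^^^ 2 ^ e.b), s.mask ||| 2 ^ k, s.P + e.P, s.Q + e.Q, s.c + e.c, s.d + e.D⟩

def rmask : List Ed → ℕ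
  | [] => 0
  | e :: es => 2 ^ e.a ||| (2 ^ e.b ||| rmask es)

def enum : List Ed → ℕ → Acc → List Acc
  | [], _, s => if s.x = 0 then [s] else []
  | e :: es, k, s => if s.x ||| rmask (e :: es) = rmask (e :: es) then
      enum es (k + 1) s ++ enum es (k + 1) (s.add e k) else []

def isSq (d p : ℕ) : Bool := (d % p) ^ ((p - 1) / 2) % p == 1

def color (d : ℕ) : ℕ :=
  ((List.finRange 5).map fun k => if isSq d (pr k) then 2 ^ (k : ℕ) else 0).sum

def parities (s : Acc) : List ℕ :=
  if (s.P / 2 + s.Q / 2) % 2 = 0 then [s.c / 2 % 2] else [0, 1]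

def cells (s : Acc) : List ℕ :=
  (List.range 40).filter fun l => min (s.P / 2) (s.Q / 2) ≤ l ∧ l < max (s.P / 2) (s.Q / 2)

def keys (s : Acc) : List ℕ :=
  let col := color s.d
  (cells s).flatMap fun l => (parities s).map fun π => (l * 2 + π) * 32 + col

def goodAcc (s : Acc) : Bool :=
  s.P % 2 == 0 && s.Q % 2 == 0 && s.c % 2 == 0 && s.P != s.Q && s.P ≤ 78 && s.Q ≤ 78 &&
    s.c ≤ 100 && s.d ≤ 10 ^ 25 && (List.finRange 5).all fun k => s.d % pr k != 0

def accs (f : Fam) : List Acc :=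
  (enum f.es 0 ⟨0, 0, 0, 0, 0, 0⟩).filter fun s => s.mask != 0

def entries : List (ℕ × Acc) :=
  fams.zipIdx.flatMap fun fi => (accs fi.1).map fun s => (fi.2, s)

def bitNodup : List ℕ → ℕ → Bool
  | [], _ => true
  | k :: l, s => !(s.testBit k) && bitNodup l (s ||| 2 ^ k)

def goodFam (f : Fam) : Bool :=
  f.es.all fun e => e.a ≤ f.nv && e.b ≤ f.nv && 1 ≤ e.P + e.Q

def checkAll : Bool :=
  fams.all goodFam && entries.all (fun z => goodAcc z.2) &&
    bitNodup (entries.flatMap fun z => keys z.2) 0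

set_option maxRecDepth 100000 in
theorem checkAll_true : checkAll = true := by decide +kernel
end DC

namespace DC

def selAcc (b : ℕ → Bool) : List Ed → ℕ → Acc → Acc
  | [], _, s => s
  | e :: es, k, s => selAcc b es (k + 1) (if b k then s.add e k else s)

theorem selAcc_x_of_rmask (b : ℕ → Bool) (v : ℕ) (es : List Ed) : ∀ (k : ℕ) (s : Acc),
    (rmask es).testBit v = false → (selAcc b es k s).x.testBit v = s.x.testBit v := by
  induction es with
  | nil => intro k s _; rfl
  | cons e es ih =>
    intro k s h
    simp only [rmask, Nat.testBit_or, Bool.or_eq_false_iff] at h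
    simp only [selAcc]
    rw [ih _ _ h.2.2]
    split_ifs
    · simp [Acc.add, Nat.testBit_xor, h.1, h.2.1]
    · rfl

theorem selAcc_mem (b : ℕ → Bool) (es : List Ed) : ∀ (k : ℕ) (s : Acc),
    (selAcc b es k s).x = 0 → selAcc b es k s ∈ enum es k s := by
  induction es with
  | nil => intro k s h; simpa [selAcc, enum] using h
  | cons e es ih =>
    intro k s h
    have h1 : s.x ||| rmask (e :: es) = rmask (e :: es) := by
      apply Nat.eq_of_testBit_eq
      intro v
      rw [Nat.testBit_or]
      cases hv : (rmask (e :: es)).testBit v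
      · have := selAcc_x_of_rmask b v (e :: es) k s hv
        rw [h] at this
        simp [← this]
      · simp
    rw [enum, if_pos h1, List.mem_append]
    rw [selAcc] at h ⊢
    cases hb : b k
    · left; simp only [hb] at h ⊢; exact ih _ _ h
    · right; simp only [hb] at h ⊢; exact ih _ _ h

theorem selAcc_sum (F : Acc → ℕ) (G : Ed → ℕ) (hFG : ∀ s e k, F (s.add e k) = F s + G e)
    (b : ℕ → Bool) (es : List Ed) : ∀ (k : ℕ) (s : Acc),
    F (selAcc b es k s) = F s + ∑ i : Fin es.length, if b (k + i) then G es[i] else 0 := by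
  induction es with
  | nil => intro k s; simp [selAcc]
  | cons e es ih =>
    intro k s
    rw [selAcc, ih]
    simp only [List.length_cons, Fin.sum_univ_succ]
    cases hb : b k <;> simp [hb, hFG, add_assoc, add_comm, add_left_comm]

theorem selAcc_mask (b : ℕ → Bool) (v : ℕ) (es : List Ed) : ∀ (k : ℕ) (s : Acc),
    (selAcc b es k s).mask.testBit v =
      (s.mask.testBit v || (decide (k ≤ v ∧ v < k + es.length) && b v)) := by
  induction es with
  | nil => intro k s; simp [selAcc]
  | cons e es ih =>
    intro k s
    rw [selAcc, ih]
    rcases eq_or_ne k v with rfl | hkv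
    · cases hb : b k <;> simp [Acc.add, Nat.testBit_or]
    · have h1 : decide (k ≤ v ∧ v < k + (e :: es).length) =
          decide (k + 1 ≤ v ∧ v < k + 1 + es.length) := by
        rw [decide_eq_decide, List.length_cons]; omega
      rw [h1]
      cases hb : b k <;> simp [Acc.add, Nat.testBit_or, Nat.testBit_two_pow, hkv]

theorem selAcc_x (b : ℕ → Bool) (v : ℕ) (es : List Ed) : ∀ (k : ℕ) (s : Acc),
    (selAcc b es k s).x.testBit v = (s.x.testBit v ^^ decide (Odd (∑ i : Fin es.length,
      if b (k + i) then ((if es[i].a = v then 1 else 0) + (if es[i].b = v then 1 else 0)) else 0))) := by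
  induction es with
  | nil => intro k s; simp [selAcc]
  | cons e es ih =>
    intro k s
    rw [selAcc, ih]
    simp only [List.length_cons, Fin.sum_univ_succ]
    have : ∀ i : Fin es.length, k + ((i.succ : Fin (es.length + 1)) : ℕ) = k + 1 + i := by
      intro i; simp; omega
    simp only [this]
    simp only [Fin.getElem_fin, Fin.val_succ, List.getElem_cons_succ, Fin.val_zero, add_zero,
      List.getElem_cons_zero]
    generalize (∑ i : Fin es.length, if b (k + 1 + ↑i) = true then
      (if es[(i : ℕ)].a = v then 1 else 0) + (if es[(i : ℕ)].b = v then 1 else 0) else 0) = X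
    cases hb : b k
    · simp
    · simp only [Acc.add, if_true, Nat.testBit_xor, Nat.testBit_two_pow, Nat.odd_add']
      rcases Nat.even_or_odd X with hX | hX
      · by_cases h1 : e.a = v <;> by_cases h2 : e.b = v <;>
          simp [h1, h2, hX, Nat.not_odd_iff_even.2 hX]
      · by_cases h1 : e.a = v <;> by_cases h2 : e.b = v <;>
          simp [h1, h2, hX, Nat.not_even_iff_odd.2 hX]

theorem bitNodup_spec (l : List ℕ) : ∀ s, bitNodup l s = true →
    l.Nodup ∧ ∀ k ∈ l, s.testBit k = false := by
  induction l with
  | nil => intro s _; simp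
  | cons k l ih =>
    intro s h
    simp only [bitNodup, Bool.and_eq_true, Bool.not_eq_true'] at h
    obtain ⟨h1, h2⟩ := ih _ h.2
    simp only [Nat.testBit_or, Bool.or_eq_false_iff] at h2
    refine ⟨List.nodup_cons.2 ⟨fun hk => ?_, h1⟩, ?_⟩
    · have := (h2 k hk).2
      simp at this
    · intro x hx
      rcases List.mem_cons.1 hx with rfl | hx
      · exact h.1
      · exact (h2 x hx).1

theorem key_unique {z z' : ℕ × Acc} (hz : z ∈ entries) (hz' : z' ∈ entries) (κ : ℕ)
    (hκ : κ ∈ keys z.2) (hκ' : κ ∈ keys z'.2) : z = z' := by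
  have h := checkAll_true
  simp only [checkAll, Bool.and_eq_true] at h
  have hn := (bitNodup_spec _ _ h.2).1
  rw [List.nodup_flatMap] at hn
  by_contra hne
  have hp := hn.2
  have : Std.Symm (Function.onFun List.Disjoint fun z : ℕ × Acc => keys z.2) :=
    ⟨fun a b h => h.symm⟩
  have := hp.forall hz hz' hne
  exact this hκ hκ'

theorem entries_good {z : ℕ × Acc} (hz : z ∈ entries) : goodAcc z.2 = true := by
  have h := checkAll_true
  simp only [checkAll, Bool.and_eq_true, List.all_eq_true] at h
  exact h.1.2 z hz

theorem fams_good {f : Fam} (hf : f ∈ fams) : goodFam f = true := by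
  have h := checkAll_true
  simp only [checkAll, Bool.and_eq_true, List.all_eq_true] at h
  exact h.1.1 f hf

end DC

namespace DC

def toV (nv a : ℕ) : Option (Fin nv) :=
  if h : 0 < a ∧ a ≤ nv then some ⟨a - 1, by omega⟩ else none

theorem toV_inj {nv a v : ℕ} (ha : a ≤ nv) (hv : v ≤ nv) : toV nv a = toV nv v ↔ a = v := by
  constructor
  · intro h
    unfold toV at h
    split_ifs at h <;> simp_all <;> omega
  · rintro rfl; rfl

theorem T_acc (fi : ℕ) (f : Fam) (hzip : (f, fi) ∈ fams.zipIdx) (T : Finset (Fin f.es.length))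
    (hT : T.Nonempty)
    (hev : EvenAt (fun e : Fin f.es.length => toV f.nv f.es[e].a)
      (fun e => toV f.nv f.es[e].b) T) :
    ∃ s : Acc, (fi, s) ∈ entries ∧ s.P = ∑ e ∈ T, f.es[e].P ∧
      s.Q = ∑ e ∈ T, f.es[e].Q ∧ s.c = ∑ e ∈ T, f.es[e].c ∧
      s.d = ∑ e ∈ T, f.es[e].D ∧
      ∀ i : Fin f.es.length, s.mask.testBit i = decide (i ∈ T) := by
  have hmem : f ∈ fams := by
    rw [List.mk_mem_zipIdx_iff_getElem?] at hzip
    exact List.mem_of_getElem? hzip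
  have hgood := fams_good hmem
  set b : ℕ → Bool := fun i => if h : i < f.es.length then decide (⟨i, h⟩ ∈ T) else false with hb
  have hbi : ∀ i : Fin f.es.length, b (0 + i) = decide (i ∈ T) := by
    intro i; simp [hb]
  have hsum : ∀ F : Fin f.es.length → ℕ, (∑ i : Fin f.es.length, if b (0 + i) then F i else 0) =
      ∑ e ∈ T, F e := by
    intro F
    simp only [hbi, decide_eq_true_eq]
    simp
  let s0 : Acc := ⟨0, 0, 0, 0, 0, 0⟩
  have hmask : ∀ i : Fin f.es.length, (selAcc b f.es 0 s0).mask.testBit i = decide (i ∈ T) := by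
    intro i
    rw [selAcc_mask]
    have := hbi i
    rw [zero_add] at this
    simp [s0, this]
  simp only [goodFam, List.all_eq_true, Bool.and_eq_true, decide_eq_true_eq] at hgood
  have hx : (selAcc b f.es 0 s0).x = 0 := by
    apply Nat.eq_of_testBit_eq
    intro v
    rw [selAcc_x, hsum (fun i => (if f.es[i].a = v then 1 else 0) + (if f.es[i].b = v then 1 else 0))]
    simp only [s0, Nat.zero_testBit, Bool.false_bne, decide_eq_false_iff_not, Nat.not_odd_iff_even]
    by_cases hv : v ≤ f.nv
    · have h := hev (toV f.nv v)
      refine Eq.mp ?_ h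
      congr 1
      refine Finset.sum_congr rfl fun e _ => ?_
      have h1 := hgood f.es[e] (List.getElem_mem _)
      simp only [toV_inj h1.1.1 hv, toV_inj h1.1.2 hv]
    · rw [Finset.sum_eq_zero]
      · simp
      · intro e _
        have h1 := hgood f.es[e] (List.getElem_mem _)
        simp only [if_neg (show ¬ f.es[e].a = v by omega), if_neg (show ¬ f.es[e].b = v by omega), add_zero]
  refine ⟨selAcc b f.es 0 s0, ?_, ?_, ?_, ?_, ?_, hmask⟩
  · rw [entries, List.mem_flatMap]
    refine ⟨(f, fi), hzip, ?_⟩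
    rw [List.mem_map]
    refine ⟨_, ?_, rfl⟩
    rw [accs, List.mem_filter]
    refine ⟨selAcc_mem b f.es 0 s0 hx, ?_⟩
    obtain ⟨i, hi⟩ := hT
    have := hmask i
    rw [bne_iff_ne]
    intro h0
    rw [h0] at this
    simp [hi] at this
  · rw [← hsum (fun e => f.es[e].P), selAcc_sum Acc.P Ed.P (fun _ _ _ => rfl)]; simp [s0]
  · rw [← hsum (fun e => f.es[e].Q), selAcc_sum Acc.Q Ed.Q (fun _ _ _ => rfl)]; simp [s0]
  · rw [← hsum (fun e => f.es[e].c), selAcc_sum Acc.c Ed.c (fun _ _ _ => rfl)]; simp [s0]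
  · rw [← hsum (fun e => f.es[e].D), selAcc_sum Acc.d Ed.D (fun _ _ _ => rfl)]; simp [s0]

end DC

namespace DC

def NN : ℕ := ∏ k, pr k
def MM (k : Fin 5) : ℕ := ∏ l ∈ Finset.univ.erase k, pr l
abbrev YY := ∀ k : Fin 5, Fin ((pr k - 1) / 2)
def ZZ (y : YY) : ℕ := ∑ k, MM k * ((y k : ℕ) + 1) ^ 2
def i0 : ℕ := 10 ^ 35

theorem pr_prime (k : Fin 5) : (pr k).Prime := by
  fin_cases k <;> simp [pr] <;> norm_num

theorem NN_odd : NN % 2 = 1 := by decide +kernel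
theorem NN_pos : 0 < NN := by decide +kernel
theorem MM_ne (k : Fin 5) : MM k % pr k ≠ 0 := by revert k; decide +kernel
theorem pr_dvd_NN (k : Fin 5) : pr k ∣ NN := Finset.dvd_prod_of_mem _ (Finset.mem_univ _)
theorem pr_dvd_MM {k l : Fin 5} (h : l ≠ k) : pr k ∣ MM l :=
  Finset.dvd_prod_of_mem _ (by simp [h.symm])
theorem MM_le (k : Fin 5) : MM k ≤ NN := by revert k; decide +kernel
theorem pr_le (k : Fin 5) : pr k ≤ 10061 := by revert k; decide +kernel
theorem pr_ge (k : Fin 5) : 10007 ≤ pr k := by revert k; decide +kernel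
theorem pr_odd (k : Fin 5) : pr k % 2 = 1 := by revert k; decide +kernel

theorem ZZ_le (y : YY) : ZZ y ≤ NN * (5 * 10000 ^ 2) := by
  have : ∀ k ∈ Finset.univ, MM k * ((y k : ℕ) + 1) ^ 2 ≤ NN * 10000 ^ 2 := by
    intro k _
    have h1 := (y k).2
    have h2 := pr_le k
    exact Nat.mul_le_mul (MM_le k) (Nat.pow_le_pow_left (by omega) 2)
  have h := Finset.sum_le_sum this
  simp only [Finset.sum_const, Finset.card_univ, Fintype.card_fin, smul_eq_mul] at h
  unfold ZZ
  linarith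

theorem ZZ_mod (y : YY) (k : Fin 5) :
    (ZZ y : ZMod (pr k)) = (MM k : ZMod (pr k)) * ((y k : ℕ) + 1 : ZMod (pr k)) ^ 2 := by
  unfold ZZ
  push_cast
  rw [Finset.sum_eq_single k]
  · intro l _ hl
    rw [(ZMod.natCast_eq_zero_iff _ _).2 (pr_dvd_MM hl), zero_mul]
  · simp

/-- value of a code word -/
def YV (s : Acc) (i i' Z : ℕ) : ℕ := NN * (i' * (s.P / 2) + i * (s.Q / 2) + s.c / 2) + 2 * Z * s.d

theorem mod_eq {s s' : Acc} {i i' j j' : ℕ} {y y' : YY}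
    (h : YV s i i' (ZZ y) = YV s' j j' (ZZ y')) (k : Fin 5) :
    ((y k : ℕ) + 1 : ZMod (pr k)) ^ 2 * s.d = ((y' k : ℕ) + 1 : ZMod (pr k)) ^ 2 * s'.d := by
  have : Fact (pr k).Prime := ⟨pr_prime k⟩
  have h1 := congrArg (Nat.cast : ℕ → ZMod (pr k)) h
  unfold YV at h1
  push_cast at h1
  rw [(ZMod.natCast_eq_zero_iff NN _).2 (pr_dvd_NN k), zero_mul, zero_mul, zero_add, zero_add,
    ZZ_mod, ZZ_mod] at h1
  have hM : (MM k : ZMod (pr k)) ≠ 0 := by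
    rw [Ne, ZMod.natCast_eq_zero_iff]
    intro hd
    exact MM_ne k (Nat.mod_eq_zero_of_dvd hd)
  have h2 : (2 : ZMod (pr k)) ≠ 0 := by
    have : ((2 : ℕ) : ZMod (pr k)) ≠ 0 := by
      rw [Ne, ZMod.natCast_eq_zero_iff]
      intro hd
      have := Nat.le_of_dvd (by norm_num) hd
      have := pr_ge k
      omega
    exact_mod_cast this
  apply mul_left_cancel₀ (mul_ne_zero h2 hM)
  linear_combination h1

theorem y_ne (y : YY) (k : Fin 5) : ((y k : ℕ) + 1 : ZMod (pr k)) ≠ 0 := by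
  have h1 := (y k).2
  have h2 := pr_ge k
  have : (((y k : ℕ) + 1 : ℕ) : ZMod (pr k)) ≠ 0 := by
    rw [Ne, ZMod.natCast_eq_zero_iff]
    intro hd
    have := Nat.le_of_dvd (by omega) hd
    omega
  exact_mod_cast this

theorem isSq_congr {d d' : ℕ} (y y' : YY) (k : Fin 5)
    (h : ((y k : ℕ) + 1 : ZMod (pr k)) ^ 2 * d = ((y' k : ℕ) + 1 : ZMod (pr k)) ^ 2 * d') :
    isSq d (pr k) = isSq d' (pr k) := by
  have : Fact (pr k).Prime := ⟨pr_prime k⟩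
  have hodd := pr_odd k
  have he : 2 * ((pr k - 1) / 2) = pr k - 1 := by omega
  have h1 := congrArg (fun x => x ^ ((pr k - 1) / 2)) h
  simp only [mul_pow, ← pow_mul, he] at h1
  rw [ZMod.pow_card_sub_one_eq_one (y_ne y k), ZMod.pow_card_sub_one_eq_one (y_ne y' k),
    one_mul, one_mul] at h1
  have h2 : d ^ ((pr k - 1) / 2) % pr k = d' ^ ((pr k - 1) / 2) % pr k := by
    have h3 : ((d ^ ((pr k - 1) / 2) : ℕ) : ZMod (pr k)) = ((d' ^ ((pr k - 1) / 2) : ℕ) : ZMod (pr k)) := by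
      push_cast; exact h1
    exact (ZMod.natCast_eq_natCast_iff' _ _ _).1 h3
  unfold isSq
  rw [← Nat.pow_mod, ← Nat.pow_mod, h2]

theorem color_congr {s s' : Acc} {i i' j j' : ℕ} {y y' : YY}
    (h : YV s i i' (ZZ y) = YV s' j j' (ZZ y')) : color s.d = color s'.d := by
  have hk : ∀ k, isSq s.d (pr k) = isSq s'.d (pr k) := fun k => isSq_congr y y' k (mod_eq h k)
  simp only [color, hk]

theorem y_inj {s : Acc} {i i' j j' : ℕ} {y y' : YY} (hd : ∀ k, s.d % pr k ≠ 0)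
    (h : YV s i i' (ZZ y) = YV s j j' (ZZ y')) : y = y' := by
  funext k
  have : Fact (pr k).Prime := ⟨pr_prime k⟩
  have h1 := mod_eq h k
  have hd' : (s.d : ZMod (pr k)) ≠ 0 := by
    rw [Ne, ZMod.natCast_eq_zero_iff]
    intro hh
    exact hd k (Nat.mod_eq_zero_of_dvd hh)
  have h2 := mul_right_cancel₀ hd' h1
  have hy := (y k).2
  have hy' := (y' k).2
  have h3 := pr_ge k
  rcases sq_eq_sq_iff_eq_or_eq_neg.1 h2 with h4 | h4
  · have h5 : (((y k : ℕ) + 1 : ℕ) : ZMod (pr k)) = (((y' k : ℕ) + 1 : ℕ) : ZMod (pr k)) := by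
      push_cast; exact h4
    rw [ZMod.natCast_eq_natCast_iff', Nat.mod_eq_of_lt (by omega), Nat.mod_eq_of_lt (by omega)] at h5
    ext; omega
  · exfalso
    have h5 : (((y k : ℕ) + 1 + ((y' k : ℕ) + 1) : ℕ) : ZMod (pr k)) = 0 := by
      push_cast; rw [h4]; ring
    rw [ZMod.natCast_eq_zero_iff] at h5
    have := Nat.le_of_dvd (by omega) h5
    omega

theorem cell_bounds (N τ i i' p q B : ℕ) (hi : i + i' = 2 * τ) (hN : 0 < N)
    (hB : B < N * i) (hB' : B < N * i') (hpq : p < q ∨ q < p) :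
    min p q ≤ (N * (i' * p + i * q) + B) / (2 * τ * N) ∧
      (N * (i' * p + i * q) + B) / (2 * τ * N) < max p q := by
  have hipos : 0 < i := Nat.pos_of_ne_zero (by rintro rfl; simp at hB)
  have hpos : 0 < 2 * τ * N := Nat.mul_pos (by omega) hN
  rw [Nat.le_div_iff_mul_le hpos, Nat.div_lt_iff_lt_mul hpos, ← hi]
  rcases hpq with h | h
  · rw [min_eq_left h.le, max_eq_right h.le]
    obtain ⟨r, rfl⟩ := Nat.exists_eq_add_of_lt h
    constructor
    · nlinarith [Nat.zero_le (N * i * r), Nat.zero_le (N * i)]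
    · nlinarith [Nat.zero_le (N * i' * r)]
  · rw [min_eq_right h.le, max_eq_left h.le]
    obtain ⟨r, rfl⟩ := Nat.exists_eq_add_of_lt h
    constructor
    · nlinarith [Nat.zero_le (N * i' * r), Nat.zero_le (N * i')]
    · nlinarith [Nat.zero_le (N * i * r)]

theorem parity_lem (N τ i i' p q β e : ℕ) (hi : i + i' = 2 * τ) (hN : N % 2 = 1)
    (hpq : (p + q) % 2 = 0) : (N * (i' * p + i * q + β) + 2 * e) % 2 = β % 2 := by
  have h1 : (i' * p + i * q) % 2 = 0 := by
    rcases Nat.mod_two_eq_zero_or_one i with h | h <;>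
    rcases Nat.mod_two_eq_zero_or_one p with h' | h' <;>
    · have a1 : i' % 2 = i % 2 := by omega
      have a2 : q % 2 = p % 2 := by omega
      rw [Nat.add_mod, Nat.mul_mod, Nat.mul_mod i q, a1, a2, h, h']
  have h2 : (i' * p + i * q + β) % 2 = β % 2 := by omega
  rw [Nat.add_mod, Nat.mul_mod, hN, h2]
  omega

theorem key_mem {s : Acc} (hs : goodAcc s = true) {i i' τ : ℕ} (hi : i + i' = 2 * τ)
    (h1 : i0 ≤ i) (h2 : i0 ≤ i') (y : YY) :
    (YV s i i' (ZZ y) / (2 * τ * NN) * 2 + YV s i i' (ZZ y) % 2) * 32 + color s.d ∈ keys s := by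
  simp only [goodAcc, Bool.and_eq_true, beq_iff_eq, bne_iff_ne, decide_eq_true_eq] at hs
  obtain ⟨⟨⟨⟨⟨⟨⟨⟨hP, hQ⟩, hc⟩, hPQ⟩, hP'⟩, hQ'⟩, hc'⟩, hd⟩, -⟩ := hs
  have hZ := ZZ_le y
  have hB : NN * (s.c / 2) + 2 * ZZ y * s.d < NN * i0 := by
    have e1 : 2 * ZZ y * s.d ≤ 2 * (NN * (5 * 10000 ^ 2)) * 10 ^ 25 :=
      Nat.mul_le_mul (Nat.mul_le_mul le_rfl hZ) hd
    have e2 : NN * (s.c / 2) ≤ NN * 50 := Nat.mul_le_mul le_rfl (by omega)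
    have := NN_pos
    unfold i0
    omega
  have hc := cell_bounds NN τ i i' (s.P / 2) (s.Q / 2) (NN * (s.c / 2) + 2 * ZZ y * s.d) hi NN_pos
    (lt_of_lt_of_le hB (Nat.mul_le_mul le_rfl h1)) (lt_of_lt_of_le hB (Nat.mul_le_mul le_rfl h2))
    (by omega)
  have hY : NN * (i' * (s.P / 2) + i * (s.Q / 2)) + (NN * (s.c / 2) + 2 * ZZ y * s.d) =
      YV s i i' (ZZ y) := by unfold YV; ring
  rw [hY] at hc
  rw [keys, List.mem_flatMap]
  refine ⟨YV s i i' (ZZ y) / (2 * τ * NN), ?_, ?_⟩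
  · rw [cells, List.mem_filter, List.mem_range]
    refine ⟨lt_of_lt_of_le hc.2 ?_, by simpa using hc⟩
    rw [max_le_iff]; omega
  · rw [List.mem_map]
    refine ⟨YV s i i' (ZZ y) % 2, ?_, rfl⟩
    rw [parities]
    split_ifs with hp
    · have := parity_lem NN τ i i' (s.P / 2) (s.Q / 2) (s.c / 2) (ZZ y * s.d) hi NN_odd hp
      rw [List.mem_singleton, ← this]
      unfold YV; congr 1; ring
    · rcases Nat.mod_two_eq_zero_or_one (YV s i i' (ZZ y)) with h | h <;> simp [h]

theorem YV_inj {z z' : ℕ × Acc} (hz : z ∈ entries) (hz' : z' ∈ entries) {i i' j j' τ : ℕ}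
    (hi : i + i' = 2 * τ) (hj : j + j' = 2 * τ) (h1 : i0 ≤ i) (h2 : i0 ≤ i') (h3 : i0 ≤ j)
    (h4 : i0 ≤ j') {y y' : YY} (h : YV z.2 i i' (ZZ y) = YV z'.2 j j' (ZZ y')) :
    z = z' ∧ y = y' ∧ i = j := by
  have hg := entries_good hz
  have k1 := key_mem (entries_good hz) hi h1 h2 y
  have k2 := key_mem (entries_good hz') hj h3 h4 y'
  rw [← h, ← color_congr h] at k2
  have hzz := key_unique hz hz' _ k1 k2
  subst hzz
  simp only [goodAcc, Bool.and_eq_true, beq_iff_eq, bne_iff_ne, decide_eq_true_eq] at hg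
  obtain ⟨⟨⟨⟨⟨⟨⟨⟨hP, hQ⟩, hc⟩, hPQ⟩, hP'⟩, hQ'⟩, hc'⟩, -⟩, hd⟩ := hg
  have hy := y_inj (by simpa using hd) h
  subst hy
  refine ⟨rfl, rfl, ?_⟩
  unfold YV at h
  have h5 := Nat.eq_of_mul_eq_mul_left NN_pos (Nat.add_right_cancel h)
  have h6 : z.2.P / 2 ≠ z.2.Q / 2 := by omega
  zify at *
  have : ((i : ℤ) - j) * ((z.2.Q / 2 : ℤ) - (z.2.P / 2 : ℤ)) = 0 := by
    have e1 : (i' : ℤ) = 2 * τ - i := by linarith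
    have e2 : (j' : ℤ) = 2 * τ - j := by linarith
    rw [e1, e2] at h5
    linear_combination h5
  rcases mul_eq_zero.1 this with h7 | h7
  · linarith
  · exfalso; apply h6; linarith
end DC

namespace DC

def edLen (μ i i' Z : ℕ) (e : Ed) : ℕ := μ * (NN * (i' * e.P + i * e.Q + e.c) + e.D * 4 * Z)

theorem sum_edLen {ι : Type*} (T : Finset ι) (F : ι → Ed) (s : Acc) (hs : goodAcc s = true)
    (hP : s.P = ∑ e ∈ T, (F e).P) (hQ : s.Q = ∑ e ∈ T, (F e).Q) (hc : s.c = ∑ e ∈ T, (F e).c)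
    (hd : s.d = ∑ e ∈ T, (F e).D) (μ i i' Z : ℕ) :
    ∑ e ∈ T, edLen μ i i' Z (F e) = 2 * μ * YV s i i' Z := by
  simp only [goodAcc, Bool.and_eq_true, beq_iff_eq, bne_iff_ne, decide_eq_true_eq] at hs
  obtain ⟨⟨⟨⟨⟨⟨⟨⟨eP, eQ⟩, ec⟩, -⟩, -⟩, -⟩, -⟩, -⟩, -⟩ := hs
  simp only [edLen, ← Finset.mul_sum, Finset.sum_add_distrib, ← Finset.sum_mul]
  rw [← hP, ← hQ, ← hc, ← hd, YV]
  have e1 : s.P = 2 * (s.P / 2) := by omega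
  have e2 : s.Q = 2 * (s.Q / 2) := by omega
  have e3 : s.c = 2 * (s.c / 2) := by omega
  generalize s.P / 2 = p at *
  generalize s.Q / 2 = q at *
  generalize s.c / 2 = c at *
  rw [e1, e2, e3]; ring

def lsum (F : Ed → ℕ) : ℕ := (fams.map fun f => (f.es.map F).sum).sum

def fam (f : Fin fams.length) : Fam := fams.get f

theorem fam_sum (F : Ed → ℕ) :
    ∑ f : Fin fams.length, ∑ e : Fin (fam f).es.length, F (fam f).es[e] = lsum F := by
  unfold lsum
  rw [← Fin.sum_univ_fun_getElem]
  refine Finset.sum_congr rfl fun f _ => ?_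
  rw [← Fin.sum_univ_fun_getElem]
  rfl

theorem lsum_PQ : lsum Ed.P + lsum Ed.Q = 6221 := by decide +kernel

def SVn : ℕ := (fams.map Fam.nv).sum
theorem sum_nv : ∑ f : Fin fams.length, (fam f).nv = SVn := by
  unfold SVn
  rw [← Fin.sum_univ_fun_getElem]
  rfl
theorem sum_ne : ∑ f : Fin fams.length, (fam f).es.length = SVn + 349 := by
  have : (fams.map fun f => f.es.length).sum = SVn + 349 := by decide +kernel
  rw [← this, ← Fin.sum_univ_fun_getElem]
  rfl

def Yc : ℕ := ∏ k, (pr k - 1) / 2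
theorem card_YY : Fintype.card YY = Yc := by
  simp only [YY, Fintype.card_pi, Fintype.card_fin, Yc]

def BB : ℕ := SVn + NN * lsum Ed.c + 4 * (NN * (5 * 10000 ^ 2)) * lsum Ed.D

theorem i0_ge : 3 ≤ i0 := by decide +kernel

theorem sum_x (h : ℕ) : ∑ j : Fin (2 * h + 1), (j : ℕ) = (2 * h + 1) * h := by
  rw [Fin.sum_univ_eq_sum_range (fun j => j)]
  have := Finset.sum_range_id_mul_two (2 * h + 1)
  apply Nat.eq_of_mul_eq_mul_right (show 0 < 2 by norm_num)
  rw [this, Nat.add_sub_cancel]; ring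

theorem sum_i (i0 h : ℕ) : ∑ j : Fin (2 * h + 1), (i0 + (j : ℕ)) = (2 * h + 1) * (i0 + h) := by
  rw [Finset.sum_add_distrib, sum_x]
  simp only [Finset.sum_const, Finset.card_univ, Fintype.card_fin, smul_eq_mul]
  ring

theorem sum_i' (i0 h : ℕ) :
    ∑ j : Fin (2 * h + 1), (i0 + 2 * h - (j : ℕ)) = (2 * h + 1) * (i0 + h) := by
  have h1 : ∑ j : Fin (2 * h + 1), (i0 + 2 * h - (j : ℕ)) + ∑ j : Fin (2 * h + 1), (i0 + (j : ℕ))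
      = (2 * h + 1) * (2 * (i0 + h)) := by
    rw [← Finset.sum_add_distrib]
    rw [Finset.sum_congr rfl (g := fun _ => 2 * (i0 + h))]
    · simp
    · intro j _
      have := j.2
      omega
  rw [sum_i] at h1
  linarith

theorem goodFam_spec (f : Fam) (h1 : goodFam f = true) (e : Fin f.es.length) :
    1 ≤ f.es[e].P + f.es[e].Q := by
  simp only [goodFam, List.all_eq_true, Bool.and_eq_true, decide_eq_true_eq] at h1
  exact (h1 f.es[e] (List.getElem_mem _)).2

attribute [local irreducible] NN YV edLen goodAcc goodFam

theorem g_lower_aux (K : ℕ) (fam : Fin K → Fam) (Y : Type) [Fintype Y] (Z : Y → ℕ)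
    (E : Set (ℕ × Acc)) (i0 Zm SP SQ SC SD SV' : ℕ) (hi0 : 3 ≤ i0) (hN : 0 < NN)
    (hgood : ∀ f, ∀ e : Fin (fam f).es.length, 1 ≤ (fam f).es[e].P + (fam f).es[e].Q)
    (hkey : ∀ f (T : Finset (Fin (fam f).es.length)), T.Nonempty →
      EvenAt (fun e : Fin (fam f).es.length => toV (fam f).nv (fam f).es[e].a)
        (fun e => toV (fam f).nv (fam f).es[e].b) T →
      ∃ s : Acc, ((f : ℕ), s) ∈ E ∧ s.P = ∑ e ∈ T, (fam f).es[e].P ∧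
      s.Q = ∑ e ∈ T, (fam f).es[e].Q ∧ s.c = ∑ e ∈ T, (fam f).es[e].c ∧
      s.d = ∑ e ∈ T, (fam f).es[e].D ∧
      ∀ i : Fin (fam f).es.length, s.mask.testBit i = decide (i ∈ T))
    (hEg : ∀ z ∈ E, goodAcc z.2 = true)
    (hinj : ∀ z ∈ E, ∀ z' ∈ E, ∀ i i' j j' τ : ℕ,
      i + i' = 2 * τ → j + j' = 2 * τ → i0 ≤ i → i0 ≤ i' → i0 ≤ j → i0 ≤ j' → ∀ y y' : Y,
      YV z.2 i i' (Z y) = YV z'.2 j j' (Z y') → z = z' ∧ y = y' ∧ i = j)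
    (hZ : ∀ y, Z y ≤ Zm)
    (sP : ∑ f, ∑ e : Fin (fam f).es.length, (fam f).es[e].P = SP)
    (sQ : ∑ f, ∑ e : Fin (fam f).es.length, (fam f).es[e].Q = SQ)
    (sC : ∑ f, ∑ e : Fin (fam f).es.length, (fam f).es[e].c = SC)
    (sD : ∑ f, ∑ e : Fin (fam f).es.length, (fam f).es[e].D = SD)
    (sv : ∑ f, (fam f).nv = SV') (se : ∑ f, (fam f).es.length = SV' + 349)
    (μ h n : ℕ) (hμ : 0 < μ)
    (hn : 4 + (2 * h + 1) * Fintype.card Y * μ * (NN * (SP + SQ) * (i0 + h) +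
      (SV' + NN * SC + 4 * Zm * SD)) ≤ n) :
    n + 349 * ((2 * h + 1) * Fintype.card Y) ≤ g n (2 * μ) + 1 := by
  classical
  let Γ := Fin K × Fin (2 * h + 1) × Y
  let nv : Γ → ℕ := fun γ => (fam γ.1).nv
  let ne : Γ → ℕ := fun γ => (fam γ.1).es.length
  let s : ∀ γ, Fin (ne γ) → Option (Fin (nv γ)) := fun γ e => toV (fam γ.1).nv (fam γ.1).es[e].a
  let t : ∀ γ, Fin (ne γ) → Option (Fin (nv γ)) := fun γ e => toV (fam γ.1).nv (fam γ.1).es[e].b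
  let len : (Σ γ, Fin (ne γ)) → ℕ := fun x =>
    edLen μ (i0 + x.1.2.1) (i0 + 2 * h - x.1.2.1) (Z x.1.2.2) (fam x.1.1).es[x.2]
  have key : ∀ γ (T : Finset (Fin (ne γ))), T.Nonempty → EvenAt (s γ) (t γ) T →
      ∃ a : Acc, ((γ.1 : ℕ), a) ∈ E ∧
        ∑ e ∈ T, len ⟨γ, e⟩ = 2 * μ * YV a (i0 + γ.2.1) (i0 + 2 * h - γ.2.1) (Z γ.2.2) ∧
        ∀ i : Fin (ne γ), a.mask.testBit i = decide (i ∈ T) := by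
    intro γ T hT hev
    obtain ⟨a, ha, hP, hQ, hc, hd, hm⟩ := hkey γ.1 T hT hev
    have hg : goodAcc a = true := hEg ((γ.1 : ℕ), a) ha
    have hS := sum_edLen T (fun e => (fam γ.1).es[e]) a hg hP hQ hc hd μ (i0 + γ.2.1)
      (i0 + 2 * h - γ.2.1) (Z γ.2.2)
    exact ⟨a, ha, hS, hm⟩
  have hsums : ∑ γ, ne γ = ∑ γ, nv γ + 349 * ((2 * h + 1) * Fintype.card Y) := by
    simp only [ne, nv, Γ, Fintype.sum_prod_type, Finset.sum_const, Finset.card_univ,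
      Fintype.card_prod, Fintype.card_fin, smul_eq_mul, ← Finset.mul_sum, sv, se]
    ring
  have hnv : ∑ γ, nv γ = (2 * h + 1) * Fintype.card Y * SV' := by
    simp only [nv, Γ, Fintype.sum_prod_type, Finset.sum_const, Finset.card_univ,
      Fintype.card_prod, Fintype.card_fin, smul_eq_mul, ← Finset.mul_sum, sv]
  have hlen : ∀ e, 3 ≤ len e := by
    rintro ⟨⟨f, j, y⟩, e⟩
    have h2 := hgood f e
    have h3 := j.2
    simp only [len, edLen]
    generalize (fam f).es[e] = x at *
    have hi1 : 3 ≤ i0 + (j : ℕ) := by omega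
    have hi2 : 3 ≤ i0 + 2 * h - (j : ℕ) := by omega
    generalize i0 + (j : ℕ) = i at *
    generalize i0 + 2 * h - (j : ℕ) = i' at *
    have h4 : 3 ≤ i' * x.P + i * x.Q + x.c := by
      have : 3 * x.P ≤ i' * x.P := Nat.mul_le_mul hi2 le_rfl
      have : 3 * x.Q ≤ i * x.Q := Nat.mul_le_mul hi1 le_rfl
      omega
    have h5 := Nat.mul_le_mul (Nat.succ_le_of_lt hN) h4
    calc 3 ≤ 1 * (1 * 3 + 0) := by norm_num
      _ ≤ _ := Nat.mul_le_mul hμ (Nat.add_le_add h5 (Nat.zero_le _))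
  have hsl : ∑ e, (len e - 1) ≤
      (2 * h + 1) * Fintype.card Y * μ * (NN * (SP + SQ) * (i0 + h) + NN * SC +
        4 * Zm * SD) := by
    calc ∑ e, (len e - 1) ≤ ∑ x : (Σ γ, Fin (ne γ)),
        μ * (NN * ((i0 + 2 * h - x.1.2.1) * (fam x.1.1).es[x.2].P +
          (i0 + x.1.2.1) * (fam x.1.1).es[x.2].Q + (fam x.1.1).es[x.2].c) +
            (fam x.1.1).es[x.2].D * 4 * Zm) := by
          refine Finset.sum_le_sum fun x _ => (Nat.sub_le _ _).trans ?_
          simp only [len, edLen]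
          gcongr
          exact hZ _
      _ = ∑ f : Fin K, ∑ j : Fin (2 * h + 1), ∑ y : Y, ∑ e : Fin (fam f).es.length,
        μ * (NN * ((i0 + 2 * h - j) * (fam f).es[e].P +
          (i0 + j) * (fam f).es[e].Q + (fam f).es[e].c) +
            (fam f).es[e].D * 4 * Zm) := by
          rw [Fintype.sum_sigma, Fintype.sum_prod_type]
          refine Finset.sum_congr rfl fun f _ => ?_
          rw [Fintype.sum_prod_type]
      _ = ∑ j : Fin (2 * h + 1), Fintype.card Y * (
        μ * (NN * ((i0 + 2 * h - j) * SP + (i0 + j) * SQ + SC) +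
            SD * 4 * Zm)) := by
          rw [Finset.sum_comm]
          refine Finset.sum_congr rfl fun j _ => ?_
          simp only [Finset.sum_const, Finset.card_univ, smul_eq_mul, ← Finset.mul_sum,
            Finset.sum_add_distrib, ← Finset.sum_mul, sP, sQ, sC, sD]
      _ ≤ _ := by
          simp only [← Finset.mul_sum, Finset.sum_add_distrib, ← Finset.sum_mul, sum_x, sum_i',
            Finset.sum_const, Finset.card_univ, Fintype.card_fin, smul_eq_mul]
          apply le_of_eq
          ring
  have hfin := g_ge_pend nv ne s t len (2 * μ) n hlen ?_ ?_ ?_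
  · rw [hsums] at hfin; omega
  · intro γ T hT hev
    obtain ⟨a, _, hs, _⟩ := key γ T hT hev
    rw [hs]; exact Dvd.intro _ rfl
  · rintro ⟨f, j, y⟩ T ⟨f', j', y'⟩ T' hT hev hT' hev' heq
    obtain ⟨a, ha, hs, hm⟩ := key _ T hT hev
    obtain ⟨a', ha', hs', hm'⟩ := key _ T' hT' hev'
    rw [hs, hs'] at heq
    have hY := Nat.eq_of_mul_eq_mul_left (by omega) heq
    have hj := j.2
    have hj' := j'.2
    obtain ⟨hz, hy, hi⟩ := hinj _ ha _ ha' _ _ _ _ (i0 + h) (by simp only; omega) (by simp only; omega)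
      (by simp only; omega) (by simp only; omega) (by simp only; omega) (by simp only; omega) _ _ hY
    rw [Prod.mk.injEq] at hz
    have hf : f = f' := Fin.ext hz.1
    have hjj : j = j' := Fin.ext (by simp only at hi; omega)
    simp only at hy
    subst hf hjj hy
    have haa := hz.2
    subst haa
    congr 1
    ext i
    have := hm i
    rw [hm' i] at this
    simpa using this.symm
  · refine le_trans ?_ hn
    rw [hnv]
    have : (2 * h + 1) * Fintype.card Y * SV' ≤ (2 * h + 1) * Fintype.card Y * μ * SV' := by
      apply Nat.mul_le_mul _ le_rfl
      exact Nat.le_mul_of_pos_right _ hμ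
    have e : (2 * h + 1) * Fintype.card Y * μ * (NN * (SP + SQ) * (i0 + h) + (SV' + NN * SC + 4 * Zm * SD)) = (2 * h + 1) * Fintype.card Y * μ * SV' +
       (2 * h + 1) * Fintype.card Y * μ * (NN * (SP + SQ) * (i0 + h) + NN * SC +
        4 * Zm * SD) := by ring
    omega

theorem fam_zip (f : Fin fams.length) : (fam f, (f : ℕ)) ∈ fams.zipIdx := by
  rw [List.mk_mem_zipIdx_iff_getElem?]; simp [fam]

theorem g_lower (μ h n : ℕ) (hμ : 0 < μ)
    (hn : 4 + (2 * h + 1) * Yc * μ * (NN * 6221 * (i0 + h) + BB) ≤ n) :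
    n + 349 * ((2 * h + 1) * Yc) ≤ g n (2 * μ) + 1 := by
  have := g_lower_aux fams.length fam YY ZZ {z | z ∈ entries} i0 (NN * (5 * 10000 ^ 2))
    (lsum Ed.P) (lsum Ed.Q) (lsum Ed.c) (lsum Ed.D) SVn i0_ge NN_pos
    (fun f e => goodFam_spec (fam f) (fams_good (List.get_mem fams f)) e)
    (fun f T hT hev => T_acc f (fam f) (fam_zip f) T hT hev)
    (fun z hz => entries_good hz)
    (fun z hz z' hz' i i' j j' τ a1 a2 a3 a4 a5 a6 y y' h => YV_inj hz hz' a1 a2 a3 a4 a5 a6 h)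
    ZZ_le (fam_sum _) (fam_sum _) (fam_sum _) (fam_sum _) sum_nv sum_ne μ h n hμ
  rw [card_YY, lsum_PQ] at this
  exact this hn
end DC

namespace DC

theorem asym (G : ℕ → ℕ) (m Y A C1 : ℕ) (hm : 0 < m)
    (hnum : 2444 * (Y * A + 1) < 1000 * (698 * Y) ^ 2)
    (hG : ∀ h n, 4 + m * (Y * A) * (h + C1) ^ 2 ≤ n → n + 349 * ((2 * h + 1) * Y) ≤ G n + 1) :
    ∀ᶠ n : ℕ in atTop, Real.sqrt 2.444 ≤ ((G n : ℝ) - n) / Real.sqrt (n / m) := by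
  have hmR : (0 : ℝ) < m := by exact_mod_cast hm
  have hx : Tendsto (fun n : ℕ => Real.sqrt ((n : ℝ) / m)) atTop atTop := by
    apply Real.tendsto_sqrt_atTop.comp
    exact (tendsto_natCast_atTop_atTop).atTop_div_const hmR
  set κ : ℝ := (Y : ℝ) * A + 1 with hκ
  have hκ0 : 0 < κ := by positivity
  have hsκ : 0 < Real.sqrt κ := Real.sqrt_pos.2 hκ0
  have hlt : Real.sqrt 2.444 * Real.sqrt κ < 698 * Y := by
    rw [← Real.sqrt_mul (by norm_num)]
    rw [Real.sqrt_lt' (by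
      have : 0 < Y := by
        rcases Nat.eq_zero_or_pos Y with h | h
        · subst h; simp at hnum
        · exact h
      positivity)]
    have h1 : (2444 : ℝ) * (Y * A + 1) < 1000 * (698 * Y) ^ 2 := by exact_mod_cast hnum
    rw [hκ]; linarith
  set a : ℝ := 698 * Y / Real.sqrt κ - Real.sqrt 2.444 with ha
  have ha0 : 0 < a := by
    rw [ha, sub_pos, lt_div_iff₀ hsκ]; exact hlt
  filter_upwards [hx.eventually_ge_atTop ((698 * Y * (1 + C1) + 1) / a),
    hx.eventually_ge_atTop ((C1 + 5) * Real.sqrt κ), hx.eventually_gt_atTop 0] with n h1 h2 h3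
  set x := Real.sqrt ((n : ℝ) / m) with hxd
  have hxx : x ^ 2 * m = n := by
    rw [hxd, Real.sq_sqrt (by positivity)]; field_simp
  have hκκ : Real.sqrt κ ^ 2 = κ := Real.sq_sqrt hκ0.le
  have hq : (C1 : ℝ) + 5 ≤ x / Real.sqrt κ := by rwa [le_div_iff₀ hsκ]
  set H := ⌊x / Real.sqrt κ⌋₊ with hH
  have hHC : C1 + 5 ≤ H := Nat.le_floor (by push_cast; exact hq)
  have hHle : (H : ℝ) ≤ x / Real.sqrt κ := Nat.floor_le (by positivity)
  have hHge : x / Real.sqrt κ < H + 1 := Nat.lt_floor_add_one _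
  have hHn : κ * m * (H : ℝ) ^ 2 ≤ n := by
    rw [le_div_iff₀ hsκ] at hHle
    have : (H * Real.sqrt κ) ^ 2 ≤ x ^ 2 := pow_le_pow_left₀ (by positivity) hHle 2
    rw [mul_pow, hκκ] at this
    rw [← hxx]
    nlinarith
  have hcond : 4 + m * (Y * A) * (H - C1 + C1) ^ 2 ≤ n := by
    rw [Nat.sub_add_cancel (by omega)]
    have e : (Y * A + 1) * m * H ^ 2 ≤ n := by
      rw [hκ] at hHn; exact_mod_cast hHn
    have e2 : 4 ≤ m * H ^ 2 := by
      have : 1 * 2 ^ 2 ≤ m * H ^ 2 := Nat.mul_le_mul hm (Nat.pow_le_pow_left (by omega) 2)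
      omega
    nlinarith
  have hg := hG _ _ hcond
  have hgR : (n : ℝ) + 349 * ((2 * ((H : ℝ) - C1) + 1) * Y) ≤ G n + 1 := by
    have : ((H - C1 : ℕ) : ℝ) = (H : ℝ) - C1 := Nat.cast_sub (by omega)
    rw [← this]; exact_mod_cast hg
  rw [le_div_iff₀ h3]
  rw [div_le_iff₀ ha0, ha] at h1
  have hY : (0 : ℝ) ≤ Y := by positivity
  have k1 : 698 * Y * (x / Real.sqrt κ) ≤ 698 * Y * ((H : ℝ) + 1) :=
    mul_le_mul_of_nonneg_left hHge.le (by positivity)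
  have k2 : x * (698 * Y / Real.sqrt κ) = 698 * Y * (x / Real.sqrt κ) := by ring
  nlinarith

theorem num_ok : 2444 * (Yc * (NN * 6221) + 1) < 1000 * (698 * Yc) ^ 2 := by decide +kernel

theorem lower_bound (m : ℕ) (hm : Even m) (hmpos : 0 < m) :
    ∀ᶠ n : ℕ in atTop, Real.sqrt 2.444 ≤ ((g n m : ℝ) - n) / Real.sqrt (n / m) := by
  obtain ⟨μ, rfl⟩ := hm
  have key : ∀ (NN i0 B Y h : ℕ), 0 < NN → (2 * h + 1) * Y * μ * (NN * 6221 * (i0 + h) + B) ≤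
      (μ + μ) * (Y * (NN * 6221)) * (h + (i0 + B + 1)) ^ 2 := by
    intro NN i0 B Y h hN
    have h1 : NN * 6221 * (i0 + h) + B ≤ NN * 6221 * (h + (i0 + B + 1)) := by
      have : B * 1 ≤ B * (NN * 6221) := Nat.mul_le_mul le_rfl (by omega)
      nlinarith
    calc _ ≤ (2 * (h + (i0 + B + 1))) * Y * μ * (NN * 6221 * (h + (i0 + B + 1))) := by
          gcongr; omega
      _ = _ := by ring
  refine asym (fun n => g n (μ + μ)) (μ + μ) Yc (NN * 6221) (i0 + BB + 1) hmpos num_ok ?_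
  intro h n hn
  have := g_lower μ h n (by omega) ((Nat.add_le_add_left (key NN i0 BB Yc h NN_pos) 4).trans hn)
  rwa [two_mul μ] at this

end DC

namespace DC

theorem bern (N r : ℕ) : N ^ (r + 1) + (r + 1) * N ^ r ≤ (N + 1) ^ (r + 1) := by
  induction r with
  | zero => simp
  | succ r ih =>
    calc _ ≤ (N + 1) * (N ^ (r + 1) + (r + 1) * N ^ r) := by
          have : 0 ≤ (r + 1) * N ^ r := Nat.zero_le _
          rw [pow_succ N (r + 1), pow_succ N r]
          nlinarith
      _ ≤ (N + 1) * (N + 1) ^ (r + 1) := Nat.mul_le_mul le_rfl ih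
      _ = _ := by ring

theorem sum_pow_le (r N : ℕ) : (r + 1) * ∑ j ∈ Finset.range N, j ^ r ≤ N ^ (r + 1) := by
  induction N with
  | zero => simp
  | succ N ih =>
    rw [Finset.sum_range_succ, mul_add]
    have := bern N r
    omega

theorem cover {α : Type*} [DecidableEq α] (E : Finset α) (C : Finset (Finset α))
    (hE : E.Nonempty) (hsub : ∀ S ∈ C, S ⊆ E) (hne : ∀ S ∈ C, S.Nonempty)
    (hinj : ∀ S ∈ C, ∀ S' ∈ C, S.card = S'.card → S = S') (r : ℕ) :
    ∃ X : Finset α, ∃ k, X.card ≤ r + k ∧ (r + 1) * k ≤ E.card ∧ ∀ S ∈ C, ∃ x ∈ S, x ∈ X := by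
  classical
  let P := Fintype.piFinset (fun _ : Fin r => E)
  have hP : P.card = E.card ^ r := by simp [P, Fintype.card_piFinset]
  have hPne : P.Nonempty := by
    rw [← Finset.card_pos, hP]; exact Nat.pow_pos hE.card_pos
  let miss : (Fin r → α) → Finset (Finset α) := fun f => C.filter fun S => ∀ i, f i ∉ S
  have hsum : ∑ f ∈ P, (miss f).card = ∑ S ∈ C, (E.card - S.card) ^ r := by
    simp only [miss, Finset.card_filter]
    rw [Finset.sum_comm]
    refine Finset.sum_congr rfl fun S hS => ?_
    rw [← Finset.card_filter]
    have : P.filter (fun f => ∀ i, f i ∉ S) = Fintype.piFinset (fun _ : Fin r => E \ S) := by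
      ext f
      simp only [P, Finset.mem_filter, Fintype.mem_piFinset, Finset.mem_sdiff]
      exact ⟨fun h i => ⟨h.1 i, h.2 i⟩, fun h => ⟨fun i => (h i).1, fun i => (h i).2⟩⟩
    rw [this, Fintype.card_piFinset, Finset.prod_const, Finset.card_univ, Fintype.card_fin,
      Finset.card_sdiff_of_subset (hsub S hS)]
  have hle : ∑ S ∈ C, (E.card - S.card) ^ r ≤ ∑ j ∈ Finset.range E.card, j ^ r := by
    have hi : Set.InjOn (fun S : Finset α => E.card - S.card) C := by
      intro S hS S' hS' h
      have h1 := Finset.card_le_card (hsub S hS)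
      have h2 := Finset.card_le_card (hsub S' hS')
      simp only at h
      exact hinj S hS S' hS' (by omega)
    rw [← Finset.sum_image (f := fun j => j ^ r) hi]
    apply Finset.sum_le_sum_of_subset
    intro j hj
    rw [Finset.mem_image] at hj
    obtain ⟨S, hS, rfl⟩ := hj
    rw [Finset.mem_range]
    have := (hne S hS).card_pos
    have := hE.card_pos
    omega
  obtain ⟨f, -, hf⟩ : ∃ f ∈ P, (r + 1) * (miss f).card ≤ E.card := by
    apply Finset.exists_le_of_sum_le hPne
    rw [← Finset.mul_sum, hsum, Finset.sum_const, hP, smul_eq_mul, ← pow_succ]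
    exact (Nat.mul_le_mul le_rfl hle).trans (sum_pow_le r _)
  let c : Finset α → α := fun S => if h : S.Nonempty then h.choose else hE.choose
  refine ⟨Finset.univ.image f ∪ (miss f).image c, (miss f).card, ?_, hf, ?_⟩
  · refine (Finset.card_union_le _ _).trans (Nat.add_le_add ?_ Finset.card_image_le)
    exact Finset.card_image_le.trans (by simp)
  · intro S hS
    by_cases h : ∀ i, f i ∉ S
    · refine ⟨c S, ?_, ?_⟩
      · simp only [c, dif_pos (hne S hS)]; exact (hne S hS).choose_spec
      · exact Finset.mem_union_right _ (Finset.mem_image_of_mem _ (Finset.mem_filter.2 ⟨hS, h⟩))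
    · push Not at h
      obtain ⟨i, hi⟩ := h
      exact ⟨f i, hi, Finset.mem_union_left _ (Finset.mem_image_of_mem _ (Finset.mem_univ _))⟩

theorem acyclic_card {n : ℕ} (hn : 0 < n) (G : SimpleGraph (Fin n)) (h : G.IsAcyclic) :
    G.edgeSet.ncard ≤ n := by
  classical
  have : Nonempty (Fin n) := ⟨⟨0, hn⟩⟩
  obtain ⟨F, hF, -, hT⟩ := (connected_top (V := Fin n)).exists_isTree_le_of_le_of_isAcyclic
    (le_top (a := G)) h
  have h1 := hT.card_edgeFinset
  rw [Fintype.card_fin] at h1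
  have h2 : G.edgeSet.ncard ≤ F.edgeSet.ncard :=
    Set.ncard_le_ncard (edgeSet_mono hF) (Set.toFinite _)
  rw [← coe_edgeFinset F, Set.ncard_coe_finset] at h2
  omega

theorem edges_upper {n : ℕ} (hn : 0 < n) (G : SimpleGraph (Fin n)) (hG : distinctCycleLengths G)
    (r : ℕ) : ∃ k, G.edgeSet.ncard ≤ n + r + k ∧ (r + 1) * k ≤ G.edgeSet.ncard := by
  classical
  by_cases hE : G.edgeFinset.Nonempty
  · let C : Finset (Finset (Sym2 (Fin n))) := Finset.univ.filter fun S =>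
      ∃ (u : Fin n) (w : G.Walk u u), w.IsCycle ∧ S = w.edges.toFinset
    have hcard : ∀ {u : Fin n} (w : G.Walk u u), w.IsCycle → w.edges.toFinset.card = w.length := by
      intro u w hw
      rw [List.toFinset_card_of_nodup hw.isTrail.edges_nodup, Walk.length_edges]
    obtain ⟨X, k, hX, hk, hcov⟩ := cover G.edgeFinset C hE
      (by
        intro S hS
        obtain ⟨u, w, hw, rfl⟩ := (Finset.mem_filter.1 hS).2
        intro e he
        rw [List.mem_toFinset] at he
        exact mem_edgeFinset.2 (w.edges_subset_edgeSet he))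
      (by
        intro S hS
        obtain ⟨u, w, hw, rfl⟩ := (Finset.mem_filter.1 hS).2
        rw [← Finset.card_pos, hcard w hw]
        have := hw.three_le_length
        omega)
      (by
        intro S hS S' hS' h
        obtain ⟨u, w, hw, rfl⟩ := (Finset.mem_filter.1 hS).2
        obtain ⟨u', w', hw', rfl⟩ := (Finset.mem_filter.1 hS').2
        rw [hcard w hw, hcard w' hw'] at h
        have := hG u u' w w' hw hw' h
        ext e
        rw [List.mem_toFinset, List.mem_toFinset]
        exact Set.ext_iff.1 this e) r
    have hN : G.edgeSet.ncard = G.edgeFinset.card := by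
      rw [← coe_edgeFinset G, Set.ncard_coe_finset]
    refine ⟨k, ?_, by rw [hN]; exact hk⟩
    have hac : (G.deleteEdges (X : Set (Sym2 (Fin n)))).IsAcyclic := by
      intro u w hw
      have hle := G.deleteEdges_le (X : Set (Sym2 (Fin n)))
      have hw' := (Walk.isCycle_mapLe hle).2 hw
      obtain ⟨e, he, heX⟩ := hcov (w.mapLe hle).edges.toFinset
        (Finset.mem_filter.2 ⟨Finset.mem_univ _, u, _, hw', rfl⟩)
      rw [List.mem_toFinset, Walk.edges_mapLe_eq_edges] at he
      have := w.edges_subset_edgeSet he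
      rw [edgeSet_deleteEdges] at this
      exact this.2 heX
    have h1 := acyclic_card hn _ hac
    rw [edgeSet_deleteEdges] at h1
    have h2 : G.edgeSet.ncard ≤ (G.edgeSet \ (X : Set (Sym2 (Fin n)))).ncard +
        (X : Set (Sym2 (Fin n))).ncard := Set.ncard_le_ncard_sdiff_add_ncard _ _ (Set.toFinite _)
    rw [Set.ncard_coe_finset] at h2
    omega
  · refine ⟨0, ?_, by simp⟩
    rw [Finset.not_nonempty_iff_eq_empty] at hE
    rw [← coe_edgeFinset G, hE]
    simp

theorem g_upper (n m : ℕ) (hn : 0 < n) : (g n m : ℝ) - n ≤ 6 * Real.sqrt n := by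
  have hmem := Nat.sSup_mem (s := {e | ∃ G : SimpleGraph (Fin n), distinctCycleLengths G ∧
    (∀ (u : Fin n) (w : G.Walk u u), w.IsCycle → m ∣ w.length) ∧
    G.edgeSet.ncard = e}) ⟨0, ⊥, by
      refine ⟨?_, ?_, by simp⟩
      · intro u v w w' hw
        exact absurd hw (isAcyclic_bot w)
      · intro u w hw
        exact absurd hw (isAcyclic_bot w)⟩ (g_bdd n m)
  obtain ⟨G, hG, -, hN⟩ := hmem
  change _ = g n m at hN
  obtain ⟨k, h1, h2⟩ := edges_upper hn G hG (Nat.sqrt (g n m))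
  rw [hN] at h1 h2
  generalize g n m = N at *
  have h3 := Nat.sqrt_le' N
  have h4 := Nat.lt_succ_sqrt' N
  generalize Nat.sqrt N = s at *
  have hk : k ≤ s := by
    by_contra hh
    have : (s + 1) * (s + 1) ≤ (s + 1) * k := Nat.mul_le_mul le_rfl (by omega)
    rw [Nat.succ_eq_add_one] at h4
    nlinarith
  have hx : Real.sqrt n ^ 2 = n := Real.sq_sqrt (by positivity)
  have hx1 : 1 ≤ Real.sqrt n := by
    rw [Real.one_le_sqrt]; exact_mod_cast hn
  set x := Real.sqrt n
  have h5 : (N : ℝ) ≤ n + 2 * s := by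
    have : N ≤ n + 2 * s := by omega
    exact_mod_cast this
  have h6 : (s : ℝ) ^ 2 ≤ N := by exact_mod_cast h3
  have h7 : (s : ℝ) ≤ 3 * x := by
    by_contra hh
    push Not at hh
    nlinarith
  linarith

theorem cobdd (m : ℕ) (hm : 0 < m) :
    atTop.IsCoboundedUnder (· ≥ ·) (fun n : ℕ => ((g n m : ℝ) - n) / Real.sqrt (n / m)) := by
  refine isCoboundedUnder_ge_of_eventually_le (x := 6 * Real.sqrt m) _ ?_
  filter_upwards [eventually_gt_atTop 0] with n hn
  have hmR : (0 : ℝ) < m := by exact_mod_cast hm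
  have hnR : (0 : ℝ) < n := by exact_mod_cast hn
  rw [div_le_iff₀ (Real.sqrt_pos.2 (by positivity)), mul_assoc, ← Real.sqrt_mul hmR.le,
    mul_div_cancel₀ _ hmR.ne']
  exact g_upper n m hn

end DC

theorem stmt4 (m : ℕ) (hm : Even m) (hmpos : 0 < m) :
    Real.sqrt 2.444 ≤
      atTop.liminf (fun n : ℕ => ((g n m : ℝ) - n) / Real.sqrt (n / m)) := by
  exact le_liminf_of_le (DC.cobdd m hmpos) (DC.lower_bound m hm hmpos)
end

section
/- Let t = 1260r + 169 for some integer r ≥ 1. Then f(n) ≥ n + (119/3)t − 26399/3 for all n ≥ (1309/2)t² − (1349159/6)t + 6932215/3, where f(n) is the maximum number of edges in an n-vertex graph with all cycle lengths distinct. -/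
open SimpleGraph

/-- `f n` is the maximum number of edges in an `n`-vertex graph all of whose
cycles have distinct lengths. -/
noncomputable def f (n : ℕ) : ℕ :=
  sSup {e | ∃ G : SimpleGraph (Fin n), distinctCycleLengths G ∧ G.edgeSet.ncard = e}

namespace Caterpillar

/-- vertices other than the hub: (copy, chain, height) -/
abbrev W := ℕ × ℕ × ℕ

/-- parameters: number of copies, number of chains, leg lengths, spine lengths, last-flags -/
structure Par where
  m : ℕ
  T : ℕ
  sg : ℕ → ℕ → ℕ
  rr : ℕ → ℕ → ℕ
  lst : ℕ → ℕ
  rpos : ∀ i c, 1 ≤ rr i c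

variable (P : Par)

def par (v : W) : W :=
  if P.lst v.2.1 = 0 ∧ v.2.2 + 1 = P.sg v.1 v.2.1 + P.rr v.1 v.2.1 then
    (v.1, v.2.1 + 1, P.sg v.1 (v.2.1 + 1))
  else (v.1, v.2.1, v.2.2 + 1)

def isLeaf (v : W) : Prop := v.1 < P.m ∧ v.2.1 < P.T ∧ v.2.2 = 0

/-- strict order in which parents are larger -/
def rk (v : W) : ℕ ×ₗ ℕ := toLex (v.2.1, v.2.2)

lemma rk_lt (u v : W) : rk u < rk v ↔ u.2.1 < v.2.1 ∨ (u.2.1 = v.2.1 ∧ u.2.2 < v.2.2) := by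
  simp [rk, Prod.Lex.toLex_lt_toLex]

lemma rk_par (v : W) : rk v < rk (par P v) := by
  rw [rk_lt, par]
  split_ifs <;> simp

lemma par_ne (v : W) : par P v ≠ v := fun h => by
  have := rk_par P v
  rw [h] at this
  exact lt_irrefl _ this

/-- the forest (with the hub isolated) -/
def FF : SimpleGraph (Option W) where
  Adj x y := ∃ u v, x = some u ∧ y = some v ∧ (par P u = v ∨ par P v = u)
  symm := ⟨by
    rintro x y ⟨u, v, hx, hy, h⟩
    exact ⟨v, u, hy, hx, h.symm⟩⟩
  loopless := ⟨by
    rintro x ⟨u, v, hx, hy, h⟩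
    have : u = v := by rw [hx] at hy; exact Option.some.inj hy
    subst this
    rcases h with h | h <;> exact par_ne P u h⟩

/-- the whole graph -/
def GG : SimpleGraph (Option W) where
  Adj x y := (FF P).Adj x y ∨ (∃ u, isLeaf P u ∧ ((x = none ∧ y = some u) ∨ (y = none ∧ x = some u)))
  symm := ⟨by
    rintro x y (h | ⟨u, hu, h⟩)
    · exact Or.inl h.symm
    · exact Or.inr ⟨u, hu, h.symm⟩⟩
  loopless := ⟨by
    rintro x (h | ⟨u, hu, h⟩)
    · exact (FF P).loopless.irrefl x h
    · rcases h with ⟨h1, h2⟩ | ⟨h1, h2⟩ <;> simp [h1] at h2⟩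

lemma FF_le : FF P ≤ GG P := fun _ _ h => Or.inl h

lemma FF_adj (u v : W) : (FF P).Adj (some u) (some v) ↔ par P u = v ∨ par P v = u := by
  constructor
  · rintro ⟨a, b, ha, hb, h⟩
    cases ha; cases hb; exact h
  · intro h; exact ⟨u, v, rfl, rfl, h⟩

lemma GG_adj_none (x : Option W) (h : (GG P).Adj none x) : ∃ u, isLeaf P u ∧ x = some u := by
  rcases h with ⟨a, b, ha, hb, h⟩ | ⟨u, hu, h⟩
  · cases ha
  · rcases h with ⟨_, h⟩ | ⟨_, h⟩
    · exact ⟨u, hu, h⟩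
    · cases h

/-- extended rank -/
def rko : Option W → ℕ ×ₗ ℕ
  | none => toLex (0, 0)
  | some v => rk v

lemma FF_min (x y : Option W) (h : (FF P).Adj x y) (hle : rko x ≤ rko y) :
    ∃ u, x = some u ∧ y = some (par P u) := by
  obtain ⟨u, v, rfl, rfl, h⟩ := h
  rcases h with h | h
  · exact ⟨u, rfl, by rw [h]⟩
  · exfalso
    have := rk_par P v
    rw [h] at this
    exact absurd hle (not_le.mpr this)

lemma FF_acyclic : (FF P).IsAcyclic := by
  classical
  intro x w hw
  obtain ⟨z, hz, hmin⟩ := Finset.exists_min_image w.support.toFinset rko ⟨x, by simp⟩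
  have hz' : z ∈ w.support := by simpa using hz
  have hc := hw.rotate hz'
  set w' := w.rotate z hz' with hw'
  have hs : ∀ y ∈ w'.support, rko z ≤ rko y := by
    intro y hy
    apply hmin
    simpa [hw'] using hy
  have h1 := w'.adj_snd hc.not_nil
  have h2 := (w'.adj_penultimate hc.not_nil).symm
  obtain ⟨u, hu, e1⟩ := FF_min P _ _ h1 (hs _ (w'.getVert_mem_support _))
  obtain ⟨v, hv, e2⟩ := FF_min P _ _ h2 (hs _ (w'.getVert_mem_support _))
  have : u = v := by rw [hu] at hv; exact Option.some.inj hv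
  subst this
  exact hc.snd_ne_penultimate (e1.trans e2.symm)

/-- Every cycle is the hub plus a forest path between two distinct leaves. -/
lemma cycle_struct (x : Option W) (w : (GG P).Walk x x) (hw : w.IsCycle) :
    ∃ u v, isLeaf P u ∧ isLeaf P v ∧ u ≠ v ∧ ∃ p : (FF P).Walk (some u) (some v), p.IsPath ∧
      w.length = p.length + 2 ∧
      {e | e ∈ w.edges} = {e | e ∈ p.edges} ∪ {s(none, some u), s(none, some v)} := by
  classical
  have hG : ∀ {a b : Option W} (q : (GG P).Walk a b), none ∉ q.support →
      ∀ e ∈ q.edges, e ∈ (FF P).edgeSet := by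
    intro a b q hq e he
    induction e with
    | _ y z =>
      have hadj := q.adj_of_mem_edges he
      have hy := q.fst_mem_support_of_mem_edges he
      have hz := q.snd_mem_support_of_mem_edges he
      rcases hadj with h | ⟨u, hu, h⟩
      · exact h
      · rcases h with ⟨h, _⟩ | ⟨h, _⟩
        · rw [h] at hy; exact absurd hy hq
        · rw [h] at hz; exact absurd hz hq
  have hn : none ∈ w.support := by
    by_contra hn
    exact FF_acyclic P (w.transfer (FF P) (hG w hn)) (hw.transfer _)
  have hc := hw.rotate hn
  have hl : (w.rotate none hn).length = w.length := by simp
  have he : {e | e ∈ w.edges} = {e | e ∈ (w.rotate none hn).edges} := by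
    ext e
    exact ((w.rotate_edges none hn).perm.mem_iff).symm
  rw [he, ← hl]
  generalize w.rotate none hn = w' at hc
  cases w' with
  | nil => exact absurd rfl hc.ne_nil
  | cons h1 p =>
    rw [Walk.cons_isCycle_iff] at hc
    obtain ⟨hp, hne⟩ := hc
    obtain ⟨u, hu, rfl⟩ := GG_adj_none P _ h1
    have hpr : p.reverse.IsPath := hp.reverse
    have e3 : p.edges = p.reverse.edges.reverse := by simp
    have l3 : p.length = p.reverse.length := by simp
    rw [e3] at hne
    simp only [Walk.length_cons, Walk.edges_cons, l3, e3]
    generalize p.reverse = q at *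
    cases q with
    | cons h2 q =>
      obtain ⟨v, hv, rfl⟩ := GG_adj_none P _ h2
      rw [Walk.cons_isPath_iff] at hpr
      have huv : u ≠ v := by
        rintro rfl
        apply hne
        simp
      refine ⟨v, u, hv, hu, huv.symm, q.transfer (FF P) (hG q hpr.2), hpr.1.transfer _, ?_, ?_⟩
      · simp
      · ext e
        simp only [Walk.edges_transfer, Walk.edges_cons, List.mem_cons, List.mem_reverse,
          Set.mem_ofPred_eq, Set.mem_union, Set.mem_insert_iff, Set.mem_singleton_iff]
        tauto

lemma rk_iter (v : W) (j : ℕ) : rk v ≤ rk ((par P)^[j] v) := by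
  induction j generalizing v with
  | zero => exact le_rfl
  | succ j ih => exact (rk_par P v).le.trans (ih (par P v))

lemma up_path (v u : W) (j : ℕ) (hu : (par P)^[j] v = u) :
    ∃ p : (FF P).Walk (some v) (some u),
    p.IsPath ∧ p.length = j ∧ ∀ z ∈ p.support, ∃ k ≤ j, z = some ((par P)^[k] v) := by
  induction j generalizing v with
  | zero =>
    obtain rfl : v = u := hu
    exact ⟨Walk.nil, by simp, by simp, fun z hz => ⟨0, le_rfl, by simpa using hz⟩⟩
  | succ j ih =>
    obtain ⟨p, hp, hl, hs⟩ := ih (par P v) hu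
    refine ⟨Walk.cons ((FF_adj P _ _).2 (Or.inl rfl)) p, ?_, ?_, ?_⟩
    · rw [Walk.cons_isPath_iff]
      refine ⟨hp, fun hv => ?_⟩
      obtain ⟨k, _, hk⟩ := hs _ hv
      have h1 := rk_iter P (par P v) k
      rw [← Option.some.inj hk] at h1
      exact absurd (rk_par P v) (not_lt.mpr h1)
    · simp [hl]
    · intro z hz
      rw [Walk.support_cons, List.mem_cons] at hz
      rcases hz with rfl | hz
      · exact ⟨0, by omega, rfl⟩
      · obtain ⟨k, hk, h⟩ := hs z hz
        exact ⟨k + 1, by omega, h⟩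

lemma append_path {V : Type*} {G : SimpleGraph V} {a b c : V} (p : G.Walk a b) (q : G.Walk c b)
    (hp : p.IsPath) (hq : q.IsPath) (h : ∀ z, z ∈ p.support → z ∈ q.support → z = b) :
    (p.append q.reverse).IsPath := by
  have hr := hq.reverse
  have hm : ∀ z, z ∈ q.reverse.support ↔ z ∈ q.support := by simp
  generalize q.reverse = s at *
  rw [Walk.isPath_def, Walk.support_append]
  rw [Walk.isPath_def] at hp hr
  have hs := s.cons_tail_support.symm
  rw [hs, List.nodup_cons] at hr
  rw [List.nodup_append']
  refine ⟨hp, hr.2, ?_⟩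
  intro z hz hz'
  have := h z hz ((hm z).1 (List.mem_of_mem_tail hz'))
  subst this
  exact hr.1 hz'

/-- climbing inside a chain -/
lemma climb (i c h k : ℕ) (hk : P.lst c = 0 → h + k < P.sg i c + P.rr i c) :
    (par P)^[k] (i, c, h) = (i, c, h + k) := by
  induction k with
  | zero => rfl
  | succ k ih =>
    rw [Function.iterate_succ_apply', ih (fun h0 => by have := hk h0; omega), par]
    rw [if_neg]
    · rfl
    · rintro ⟨h0, h1⟩
      have := hk h0
      simp only at h1
      omega

/-- climbing out of a chain -/
lemma climb_out (i c h k : ℕ) (h0 : P.lst c = 0) (hk : h + k + 1 = P.sg i c + P.rr i c) :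
    (par P)^[k + 1] (i, c, h) = (i, c + 1, P.sg i (c + 1)) := by
  rw [Function.iterate_succ_apply', climb P i c h k (fun _ => by omega), par, if_pos ⟨h0, hk⟩]

def acc (g : ℕ → ℕ) (p : ℕ) : ℕ → ℕ
  | 0 => 0
  | d + 1 => acc g p d + g (p + d)

lemma climb_fan (i p d : ℕ) (h0 : acc P.lst p (d + 1) = 0) :
    (par P)^[P.sg i p + acc (P.rr i) p (d + 1)] (i, p, 0) =
      (i, p + (d + 1), P.sg i (p + (d + 1))) := by
  induction d with
  | zero =>
    have h1 := P.rpos i p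
    have : P.sg i p + acc (P.rr i) p (0 + 1) = (P.sg i p + P.rr i p - 1) + 1 := by
      simp only [acc, Nat.add_zero]; omega
    rw [this]
    apply climb_out
    · simpa [acc] using h0
    · omega
  | succ d ih =>
    have e : acc P.lst p (d + 1 + 1) = acc P.lst p (d + 1) + P.lst (p + (d + 1)) := rfl
    have e' : acc (P.rr i) p (d + 1 + 1) = acc (P.rr i) p (d + 1) + P.rr i (p + (d + 1)) := rfl
    have h1 := P.rpos i (p + (d + 1))
    have : P.sg i p + acc (P.rr i) p (d + 1 + 1) =
      (P.rr i (p + (d + 1)) - 1 + 1) + (P.sg i p + acc (P.rr i) p (d + 1)) := by omega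
    rw [this, Function.iterate_add_apply, ih (by omega)]
    exact climb_out P i (p + (d + 1)) _ _ (by omega) (by omega)

lemma iter_inv (p : W → Prop) (hp : ∀ v, p v → p (par P v)) (v : W) (h : p v) (k : ℕ) :
    p ((par P)^[k] v) := by
  induction k generalizing v with
  | zero => exact h
  | succ k ih => exact ih _ (hp v h)

lemma fan_path (i p d : ℕ) (h0 : acc P.lst p (d + 1) = 0) :
    ∃ w : (FF P).Walk (some (i, p, 0)) (some (i, p + (d + 1), 0)), w.IsPath ∧
      w.length = P.sg i p + acc (P.rr i) p (d + 1) + P.sg i (p + (d + 1)) := by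
  have hq : ∀ k ≤ P.sg i (p + (d + 1)), (par P)^[k] (i, p + (d + 1), 0) = (i, p + (d + 1), k) := by
    intro k hk
    rw [climb]
    · simp
    · intro _
      have := P.rpos i (p + (d + 1))
      omega
  obtain ⟨w1, hw1, hl1, hs1⟩ := up_path P (i, p, 0) _ _ (climb_fan P i p d h0)
  obtain ⟨w2, hw2, hl2, hs2⟩ := up_path P (i, p + (d + 1), 0) _ _ (hq _ le_rfl)
  refine ⟨w1.append w2.reverse, append_path w1 w2 hw1 hw2 ?_, by simp [hl1, hl2]⟩
  intro z hz1 hz2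
  obtain ⟨k1, _, rfl⟩ := hs1 z hz1
  obtain ⟨k2, hk2, h2⟩ := hs2 _ hz2
  rw [hq k2 hk2] at h2
  have inv := iter_inv P (fun v => v.1 = i ∧ (v.2.1 = p + (d + 1) → P.sg i (p + (d + 1)) ≤ v.2.2))
    (by
      rintro ⟨a, b, c⟩ ⟨h, h'⟩
      simp only at h h'
      subst h
      rw [par]
      split_ifs
      · refine ⟨rfl, fun e => ?_⟩
        simp only at e ⊢
        rw [e]
      · refine ⟨rfl, fun e => ?_⟩
        have := h' e
        simp only
        omega) (i, p, 0) ⟨rfl, fun e => by simp only at e; omega⟩ k1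
  rw [Option.some.inj h2] at inv ⊢
  have := inv.2 rfl
  simp only at this
  obtain rfl : k2 = P.sg i (p + (d + 1)) := by omega
  rfl

lemma walk_inv (q : W → Prop) (hq : ∀ v, q v ↔ q (par P v)) (x y : Option W)
    (w : (FF P).Walk x y) (hx : ∀ u, x = some u → q u) : ∀ v, y = some v → q v := by
  induction w with
  | nil => exact hx
  | cons h w ih =>
    apply ih
    obtain ⟨u, v, rfl, rfl, h⟩ := h
    intro z hz
    obtain rfl := Option.some.inj hz
    have := hx u rfl
    rcases h with rfl | rfl
    · exact (hq _).1 this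
    · exact (hq _).2 this

lemma acc_eq_zero (g : ℕ → ℕ) (p d : ℕ) (h : ∀ c, p ≤ c → c < p + d → g c = 0) :
    acc g p d = 0 := by
  induction d with
  | zero => rfl
  | succ d ih =>
    rw [acc, ih (fun c h1 h2 => h c h1 (by omega)), h (p + d) (by omega) (by omega)]

/-- reachable leaves are in the same fan -/
lemma same_fan (i i' p d : ℕ) (w : (FF P).Walk (some (i, p, 0)) (some (i', p + d, 0))) :
    i = i' ∧ acc P.lst p d = 0 := by
  constructor
  · have := walk_inv P (fun v => i = v.1) (fun v => by rw [par]; split_ifs <;> rfl) _ _ w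
      (by rintro _ h; rw [← Option.some.inj h]) _ rfl
    exact this
  · apply acc_eq_zero
    intro c h1 h2
    by_contra h
    have := walk_inv P (fun v => v.2.1 ≤ c) (fun v => by
      rw [par]
      split_ifs with h3
      · simp only
        constructor
        · intro h4
          rcases Nat.lt_or_ge v.2.1 c with h5 | h5
          · exact h5
          · have : v.2.1 = c := le_antisymm h4 h5
            rw [this] at h3
            exact absurd h3.1 h
        · omega
      · simp) _ _ w
      (by rintro _ h; rw [← Option.some.inj h]; exact h1) _ rfl
    simp only at this
    omega

/-- the length of the cycle through legs `p` and `p + d` of copy `i` -/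
def len (i p d : ℕ) : ℕ := P.sg i p + acc (P.rr i) p d + P.sg i (p + d) + 2

lemma path_eq {x y : Option W} (p q : (FF P).Walk x y) (hp : p.IsPath) (hq : q.IsPath) : p = q := by
  have := (FF_acyclic P).subsingleton_path x y
  have h := Subsingleton.elim (⟨p, hp⟩ : (FF P).Path x y) ⟨q, hq⟩
  exact congrArg Subtype.val h

lemma cycle_struct' (x : Option W) (w : (GG P).Walk x x) (hw : w.IsCycle) :
    ∃ i p d, i < P.m ∧ 1 ≤ d ∧ p + d < P.T ∧ acc P.lst p d = 0 ∧ w.length = len P i p d ∧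
      ∃ q : (FF P).Walk (some (i, p, 0)) (some (i, p + d, 0)), q.IsPath ∧
      {e | e ∈ w.edges} =
        {e | e ∈ q.edges} ∪ {s(none, some (i, p, 0)), s(none, some (i, p + d, 0))} := by
  obtain ⟨u, v, hu, hv, huv, p, hp, hl, he⟩ := cycle_struct P x w hw
  wlog hle : u.2.1 ≤ v.2.1 generalizing u v
  · refine this v u hv hu huv.symm p.reverse hp.reverse (by simpa using hl) ?_ (by omega)
    rw [he]
    ext e
    simp only [Walk.edges_reverse, List.mem_reverse, Set.mem_ofPred_eq, Set.mem_union,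
      Set.mem_insert_iff, Set.mem_singleton_iff]
    tauto
  obtain ⟨i, a, h⟩ := u
  obtain ⟨i', b, h'⟩ := v
  obtain ⟨h1, h2, h3⟩ := hu
  obtain ⟨h1', h2', h3'⟩ := hv
  simp only at h1 h2 h3 h1' h2' h3' hle
  subst h3 h3'
  obtain ⟨d, rfl⟩ := Nat.exists_eq_add_of_le hle
  obtain ⟨rfl, hacc⟩ := same_fan P i i' a d p
  have hd : d ≠ 0 := by
    rintro rfl
    exact huv rfl
  refine ⟨i, a, d, h1, by omega, h2', hacc, ?_, p, hp, he⟩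
  obtain ⟨d, rfl⟩ := Nat.exists_eq_succ_of_ne_zero hd
  obtain ⟨q, hq, hlq⟩ := fan_path P i a d hacc
  rw [hl, path_eq P p q hp hq, hlq, len]

lemma GG_distinct (hinj : ∀ i p d i' p' d', i < P.m → 1 ≤ d → p + d < P.T → acc P.lst p d = 0 →
    i' < P.m → 1 ≤ d' → p' + d' < P.T → acc P.lst p' d' = 0 → len P i p d = len P i' p' d' →
    i = i' ∧ p = p' ∧ d = d') : distinctCycleLengths (GG P) := by
  intro x y w w' hw hw' hl
  obtain ⟨i, p, d, h1, h2, h3, h4, h5, q, hq, h6⟩ := cycle_struct' P x w hw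
  obtain ⟨i', p', d', h1', h2', h3', h4', h5', q', hq', h6'⟩ := cycle_struct' P y w' hw'
  obtain ⟨rfl, rfl, rfl⟩ := hinj i p d i' p' d' h1 h2 h3 h4 h1' h2' h3' h4'
    (by rw [← h5, ← h5', hl])
  rw [h6, h6', path_eq P q q' hq hq']

lemma distinct_comap {V V' : Type*} (G : SimpleGraph V) (g : V' → V) (hg : Function.Injective g)
    (h : distinctCycleLengths G) : distinctCycleLengths (G.comap g) := by
  intro u v w w' hw hw' hl
  let φ : G.comap g →g G := ⟨g, fun h => h⟩
  have key := h _ _ (w.map φ) (w'.map φ)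
    ((Walk.isCycle_map_iff_of_injective hg).2 hw) ((Walk.isCycle_map_iff_of_injective hg).2 hw')
    (by simpa using hl)
  ext e
  have := Set.ext_iff.1 key (Sym2.map g e)
  simp only [Walk.edges_map, Set.mem_ofPred_eq] at this
  have hi : Function.Injective (Sym2.map φ) := Sym2.map.injective hg
  have h1 : ∀ l : List (Sym2 V'), Sym2.map g e ∈ l.map (Sym2.map φ) ↔ e ∈ l := fun l =>
    List.mem_map_of_injective hi
  rw [h1, h1] at this
  exact this

end Caterpillar
namespace Caterpillar

/-- The template: 200 chains grouped into 79 fans. The four sequences of chain data are packed into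
numerals: leg sizes and spine sizes in base 128, parity bits and last-flags in base 2. -/
def aNum : ℕ :=
  214353734424093975388816996489980380741082904928447759525570180969704015715161784127136688433200354488066615891751305009127341001569749945728
def eNum : ℕ :=
  1057900879137168598065125044124598713327136054061567513344177
def rNum : ℕ :=
  111466311579611988377927205948478725086902222846359916331309133642919323887404019434739124468651711242785716649988775743950737188110392856769133496398185275701967587170792121614445202970616848852323537820153154851810398986615443038030499810177915332061199742235141822614470976644672345794052852899707108340082501233987207477313502507466472644998216561276089586930488848494914055622044931873451842130658734831077792732989
def lNum : ℕ :=
  1071292029505993517027974728227441735014773639325371427225608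

def aF (c : ℕ) : ℕ := aNum / 128 ^ c % 128
def eF (c : ℕ) : ℕ := eNum / 2 ^ c % 2
def rF (c : ℕ) : ℕ := rNum / 128 ^ c % 128
def lF (c : ℕ) : ℕ := lNum / 2 ^ c % 2
def dF (c : ℕ) : ℕ := if rF c = 0 then 2 else 0

def cell (p d : ℕ) : ℕ := aF p + aF (p + d) + acc rF p d
def off (p d : ℕ) : ℕ := 2 + eF p + eF (p + d) + acc dF p d
def key (p d : ℕ) : ℕ := cell p d + off p d % 2

/-- packed inverse of `key`: the entry at `key p d` is `12 * p + d` -/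
def tNum : ℕ :=
  2513358504071592450965640280758409068546359699203872128482347367556860656085380073100431423629896877956895330032394608895044451931714711868792262788976604426994030133323891792378837773044108442707385404694133588250818847385578771831417233440947260301296722196410209901154843048489984793507575526863083023652607302802045438301519064499903408210141429626273590153813250673345706237516656649592751436625091631688392447439637157806391523501770976270854774671858209441819010848373265012271621546937171657738192243289564405405518766221269502101922711393171129239104213548644646108792008163405265619858406119383509328793832483206265080475233683819835136497172846751349307997514816953527728974334684022838024169659143576966421020863849620564358006334728593040703397406359457802560767993822741262456835835665988266821882227279846140997211357713401178878704979271034949044520233720210861815457726048811461582914624518571667147415505872299023114562174705316013432326450473678371789531725306478519883101222261891434768597799632114747186972296976689297229650382641223217584293837732491243177546236868006171988929022671709217098305275667363542710998754288246271090729979213601819077547775860778388324865884267684078137928181416664805513111355208309452120917406437753285973553745249683912497766150566354956104987648394676564923465233291759550684687304265767165501846812478838323665093644287362400147155529074566517207816040529446383221345238480251468449036031450666723660121849479627512018172748273076946573107179013526817862741385158602684913058975494648689502578648023188248265192315807624901262687534658004452867914558112550814212003355113383187723273519100559445275837035884060119857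

/-- the check of one pair of legs -/
def chk (p d : ℕ) : Bool :=
  match acc lF p d with
  | 0 => Nat.beq (cell p d % 2) 0 && (Nat.ble (off p d) 5 &&
      Nat.beq (tNum / 4096 ^ key p d % 4096) (12 * p + d))
  | _ + 1 => true

def chkRow (p : ℕ) : ℕ → Bool
  | 0 => true
  | d + 1 => chk p (d + 1) && chkRow p d

def chkAll : ℕ → Bool
  | 0 => true
  | p + 1 => Nat.ble 1 (acc lF p 12) && (chkRow p 11 && chkAll p)

set_option maxRecDepth 100000 in
lemma chkAll_true : chkAll 200 = true := by decide +kernel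

lemma chkRow_spec (p k d : ℕ) (h : chkRow p k = true) (h1 : 1 ≤ d) (h2 : d ≤ k) :
    chk p d = true := by
  induction k with
  | zero => omega
  | succ k ih =>
    rw [chkRow, Bool.and_eq_true] at h
    rcases Nat.lt_or_ge k d with h3 | h3
    · obtain rfl : d = k + 1 := by omega
      exact h.1
    · exact ih h.2 h3

lemma chkAll_spec (k p : ℕ) (h : chkAll k = true) (hp : p < k) :
    1 ≤ acc lF p 12 ∧ chkRow p 11 = true := by
  induction k with
  | zero => omega
  | succ k ih =>
    rw [chkAll, Bool.and_eq_true, Bool.and_eq_true] at h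
    rcases Nat.lt_or_ge p k with h3 | h3
    · exact ih h.2.2 h3
    · obtain rfl : p = k := by omega
      exact ⟨Nat.le_of_ble_eq_true h.1, h.2.1⟩

lemma acc_mono (g : ℕ → ℕ) (p d d' : ℕ) (h : d ≤ d') : acc g p d ≤ acc g p d' := by
  induction d' with
  | zero => simp_all
  | succ k ih =>
    rcases Nat.lt_or_ge k d with h1 | h1
    · have : d = k + 1 := by omega
      rw [this]
    · exact (ih h1).trans (Nat.le_add_right _ _)

lemma pair_spec (p d : ℕ) (h1 : 1 ≤ d) (h2 : p + d < 200) (h3 : acc lF p d = 0) :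
    cell p d % 2 = 0 ∧ off p d ≤ 5 ∧ d < 12 ∧ tNum / 4096 ^ key p d % 4096 = 12 * p + d := by
  obtain ⟨h4, h5⟩ := chkAll_spec 200 p chkAll_true (by omega)
  have hd : d < 12 := by
    by_contra h
    have h6 := acc_mono lF p 12 d (by omega)
    omega
  have h6 := chkRow_spec p 11 d h5 h1 (by omega)
  rw [chk, h3] at h6
  simp only [Bool.and_eq_true] at h6
  exact ⟨Nat.eq_of_beq_eq_true h6.1, Nat.le_of_ble_eq_true h6.2.1, hd,
    Nat.eq_of_beq_eq_true h6.2.2⟩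

def PP (m : ℕ) : Par where
  m := m
  T := 200
  sg i c := (m + 2) * aF c + i + eF c
  rr _ c := (m + 2) * rF c + dF c
  lst := lF
  rpos i c := by
    rw [dF]
    split_ifs with h
    · omega
    · have : 1 ≤ (m + 2) * rF c := Nat.mul_pos (by omega) (by omega)
      omega

lemma acc_lin (M : ℕ) (g h : ℕ → ℕ) (p d : ℕ) :
    acc (fun c => M * g c + h c) p d = M * acc g p d + acc h p d := by
  induction d with
  | zero => simp [acc]
  | succ d ih => simp only [acc, ih]; ring

lemma len_PP (m i p d : ℕ) : len (PP m) i p d = (m + 2) * cell p d + 2 * i + off p d := by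
  have : acc ((PP m).rr i) p d = (m + 2) * acc rF p d + acc dF p d := acc_lin _ _ _ _ _
  rw [len, this, cell, off]
  simp only [PP]
  ring

lemma PP_distinct (m : ℕ) : distinctCycleLengths (GG (PP m)) := by
  apply GG_distinct
  intro i p d i' p' d' h1 h2 h3 h4 h1' h2' h3' h4' hl
  obtain ⟨c1, c2, c3, c4⟩ := pair_spec p d h2 h3 h4
  obtain ⟨c1', c2', c3', c4'⟩ := pair_spec p' d' h2' h3' h4'
  rw [len_PP, len_PP] at hl
  have g1 : i < m := h1
  have g1' : i' < m := h1'
  obtain ⟨k, hk⟩ : ∃ k, cell p d = 2 * k := ⟨cell p d / 2, by omega⟩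
  obtain ⟨k', hk'⟩ : ∃ k, cell p' d' = 2 * k := ⟨cell p' d' / 2, by omega⟩
  rw [hk, hk'] at hl
  have hkk : k = k' := by
    rcases lt_trichotomy k k' with h | h | h
    · obtain ⟨s, rfl⟩ := Nat.exists_eq_add_of_lt h
      exfalso
      nlinarith [Nat.zero_le (m * s), Nat.zero_le s]
    · exact h
    · obtain ⟨s, rfl⟩ := Nat.exists_eq_add_of_lt h
      exfalso
      nlinarith [Nat.zero_le (m * s), Nat.zero_le s]
  subst hkk
  have hkey : key p d = key p' d' := by rw [key, key]; omega
  rw [hkey, c4'] at c4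
  obtain rfl : p = p' := by omega
  obtain rfl : d = d' := by omega
  exact ⟨by omega, rfl, rfl⟩

end Caterpillar
namespace Caterpillar

section count
variable (P : Par) (L : ℕ → ℕ → ℕ)

def emb : (Σ _ : ℕ × ℕ, ℕ) ↪ W :=
  ⟨fun z => (z.1.1, z.1.2, z.2), by
    rintro ⟨⟨a, b⟩, c⟩ ⟨⟨a', b'⟩, c'⟩ h
    simp only [Prod.mk.injEq] at h
    obtain ⟨rfl, rfl, rfl⟩ := h
    rfl⟩

def SS : Finset W :=
  ((Finset.range P.m ×ˢ Finset.range P.T).sigma (fun x => Finset.range (L x.1 x.2))).map emb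

lemma mem_SS (i c h : ℕ) : (i, c, h) ∈ SS P L ↔ i < P.m ∧ c < P.T ∧ h < L i c := by
  simp only [SS, Finset.mem_map, Finset.mem_sigma, Finset.mem_product, Finset.mem_range]
  constructor
  · rintro ⟨⟨⟨a, b⟩, k⟩, ⟨⟨h1, h2⟩, h3⟩, h4⟩
    simp only [emb, Function.Embedding.coeFn_mk, Prod.mk.injEq] at h4
    obtain ⟨rfl, rfl, rfl⟩ := h4
    exact ⟨h1, h2, h3⟩
  · rintro ⟨h1, h2, h3⟩
    exact ⟨⟨(i, c), h⟩, ⟨⟨h1, h2⟩, h3⟩, rfl⟩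

lemma card_SS : (SS P L).card = ∑ i ∈ Finset.range P.m, ∑ c ∈ Finset.range P.T, L i c := by
  rw [SS, Finset.card_map, Finset.card_sigma, Finset.sum_product]
  simp

lemma finite_graph (hd : distinctCycleLengths (GG P)) (hT : P.lst (P.T - 1) ≠ 0)
    (hL0 : ∀ i c, P.lst c = 0 → L i c = P.sg i c + P.rr i c)
    (hL1 : ∀ i c, P.sg i c < L i c) (n : ℕ) (hn : n = (SS P L).card + 1) :
    ∃ G : SimpleGraph (Fin n), distinctCycleLengths G ∧
      (SS P L).card + P.m * P.T ≤
        G.edgeSet.ncard + P.m * ((Finset.range P.T).filter fun c => P.lst c ≠ 0).card := by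
  classical
  let e : Fin n ≃ Option (SS P L) :=
    (Fintype.equivFinOfCardEq (by simp [hn])).symm
  let g : Fin n → Option W := fun x => (e x).map Subtype.val
  have hg : Function.Injective g :=
    (Option.map_injective Subtype.val_injective).comp e.injective
  have g0 : ∃ x, g x = none := ⟨e.symm none, by simp [g]⟩
  have g1 : ∀ v ∈ SS P L, ∃ x, g x = some v := fun v hv =>
    ⟨e.symm (some ⟨v, hv⟩), by simp [g]⟩
  refine ⟨(GG P).comap g, distinct_comap _ g hg hd, ?_⟩
  set tops := (SS P L).filter fun v => P.lst v.2.1 ≠ 0 ∧ v.2.2 + 1 = L v.1 v.2.1 with htops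
  set rest := (SS P L).filter fun v => ¬ (P.lst v.2.1 ≠ 0 ∧ v.2.2 + 1 = L v.1 v.2.1) with hrest
  have hcard : tops.card + rest.card = (SS P L).card :=
    Finset.card_filter_add_card_filter_not _
  have htc : tops.card ≤ P.m * ((Finset.range P.T).filter fun c => P.lst c ≠ 0).card := by
    have hsub : tops ⊆ (Finset.range P.m ×ˢ
        (Finset.range P.T).filter fun c => P.lst c ≠ 0).image
        (fun x => (x.1, x.2, L x.1 x.2 - 1)) := by
      rintro ⟨i, c, h⟩ hv
      rw [htops, Finset.mem_filter, mem_SS] at hv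
      obtain ⟨⟨h1, h2, h3⟩, h4, h5⟩ := hv
      simp only at h4 h5
      rw [Finset.mem_image]
      refine ⟨(i, c), ?_, ?_⟩
      · simp [h1, h2, h4]
      · simp only [Prod.mk.injEq, true_and]
        omega
    refine (Finset.card_le_card hsub).trans (Finset.card_image_le.trans ?_)
    rw [Finset.card_product, Finset.card_range]
  have hpar : ∀ v ∈ rest, par P v ∈ SS P L := by
    rintro ⟨i, c, h⟩ hv
    rw [hrest, Finset.mem_filter, mem_SS] at hv
    obtain ⟨⟨h1, h2, h3⟩, h4⟩ := hv
    simp only at h4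
    rw [par]
    split_ifs with h5
    · simp only at h5 ⊢
      rw [mem_SS]
      refine ⟨h1, ?_, hL1 _ _⟩
      by_contra h6
      have : c = P.T - 1 := by omega
      rw [← this] at hT
      exact hT h5.1
    · simp only at h5 ⊢
      rw [mem_SS]
      refine ⟨h1, h2, ?_⟩
      by_cases h6 : P.lst c = 0
      · have := hL0 i c h6
        have : h + 1 ≠ P.sg i c + P.rr i c := fun h7 => h5 ⟨h6, h7⟩
        omega
      · have : h + 1 ≠ L i c := fun h7 => h4 ⟨h6, h7⟩
        omega
  let E1 : Finset (Sym2 (Option W)) := rest.image fun v => s(some v, some (par P v))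
  let E2 : Finset (Sym2 (Option W)) :=
    (Finset.range P.m ×ˢ Finset.range P.T).image fun x => s(none, some (x.1, x.2, 0))
  have c1 : E1.card = rest.card := by
    apply Finset.card_image_of_injective
    intro u v huv
    rw [Sym2.eq_iff] at huv
    rcases huv with ⟨h, _⟩ | ⟨h, h'⟩
    · exact Option.some.inj h
    · exfalso
      have a1 := rk_par P u
      have a2 := rk_par P v
      rw [Option.some.inj h'] at a1
      rw [← Option.some.inj h] at a2
      exact lt_asymm a1 a2
  have c2 : E2.card = P.m * P.T := by
    rw [Finset.card_image_of_injective, Finset.card_product, Finset.card_range, Finset.card_range]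
    rintro ⟨a, b⟩ ⟨a', b'⟩ h
    rw [Sym2.eq_iff] at h
    rcases h with ⟨_, h⟩ | ⟨h, _⟩
    · have := Option.some.inj h
      simp only [Prod.mk.injEq, and_true] at this
      simp [this]
    · cases h
  have hdis : Disjoint E1 E2 := by
    rw [Finset.disjoint_left]
    intro z h1 h2
    obtain ⟨v, _, rfl⟩ := Finset.mem_image.1 h1
    obtain ⟨x, _, h⟩ := Finset.mem_image.1 h2
    rw [Sym2.eq_iff] at h
    rcases h with ⟨h, _⟩ | ⟨h, _⟩ <;> cases h
  have hsub : (↑(E1 ∪ E2) : Set (Sym2 (Option W))) ⊆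
      (Sym2.map g) '' ((GG P).comap g).edgeSet := by
    intro z hz
    rw [Finset.mem_coe, Finset.mem_union] at hz
    rcases hz with hz | hz
    · obtain ⟨v, hv, rfl⟩ := Finset.mem_image.1 hz
      obtain ⟨x, hx⟩ := g1 v (Finset.mem_filter.1 hv).1
      obtain ⟨y, hy⟩ := g1 _ (hpar v hv)
      refine ⟨s(x, y), ?_, by simp [hx, hy]⟩
      rw [SimpleGraph.mem_edgeSet, SimpleGraph.comap_adj, hx, hy]
      exact FF_le P ((FF_adj P _ _).2 (Or.inl rfl))
    · obtain ⟨⟨i, c⟩, hv, rfl⟩ := Finset.mem_image.1 hz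
      rw [Finset.mem_product, Finset.mem_range, Finset.mem_range] at hv
      obtain ⟨x, hx⟩ := g0
      obtain ⟨y, hy⟩ := g1 (i, c, 0) ((mem_SS P L _ _ _).2
        ⟨hv.1, hv.2, (Nat.zero_le _).trans_lt (hL1 i c)⟩)
      refine ⟨s(x, y), ?_, by simp [hx, hy]⟩
      rw [SimpleGraph.mem_edgeSet, SimpleGraph.comap_adj, hx, hy]
      exact Or.inr ⟨(i, c, 0), ⟨hv.1, hv.2, rfl⟩, Or.inl ⟨rfl, rfl⟩⟩
  have hfin := Set.ncard_le_ncard hsub ((Set.toFinite _).image _)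
  rw [Set.ncard_coe_finset, Finset.card_union_of_disjoint hdis, c1, c2,
    Set.ncard_image_of_injective _ (Sym2.map.injective hg)] at hfin
  omega

end count

def alpha (c : ℕ) : ℕ := aF c + if lF c = 0 then rF c else 0
def beta (c : ℕ) : ℕ := eF c + if lF c = 0 then dF c else 1

lemma sum_alpha : ∑ c ∈ Finset.range 200, alpha c = 5989 := by decide +kernel
lemma sum_beta : ∑ c ∈ Finset.range 200, beta c = 142 := by decide +kernel
lemma card_last : ((Finset.range 200).filter fun c => lF c ≠ 0).card = 79 := by decide +kernel
lemma last_last : lF 199 ≠ 0 := by decide +kernel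

/-- number of vertices on each chain, the extra `pad` ones on the last chain of copy 0 -/
def LL (m pad i c : ℕ) : ℕ :=
  (m + 2) * alpha c + i + beta c + if i = 0 ∧ c = 199 then pad else 0

lemma card_LL (m pad : ℕ) (hm : 1 ≤ m) :
    (SS (PP m) (LL m pad)).card = 6089 * m ^ 2 + 12020 * m + pad := by
  have hT : (PP m).T = 200 := rfl
  have hM : (PP m).m = m := rfl
  rw [card_SS, hT, hM]
  have h1 : ∀ i, ∑ c ∈ Finset.range 200, LL m pad i c =
      (m + 2) * 5989 + 200 * i + 142 + if i = 0 then pad else 0 := by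
    intro i
    simp only [LL, Finset.sum_add_distrib, ← Finset.mul_sum, sum_alpha, sum_beta]
    have : ∑ c ∈ Finset.range 200, (if i = 0 ∧ c = 199 then pad else 0) =
        if i = 0 then pad else 0 := by
      split_ifs with h
      · simp [h]
      · simp [h]
    rw [this]
    simp
  simp only [h1]
  rw [Finset.sum_add_distrib]
  have h2 : ∑ i ∈ Finset.range m, (if i = 0 then pad else 0) = pad := by
    rw [Finset.sum_ite_eq']
    simp
    omega
  rw [h2]
  have h3 : ∀ M k : ℕ, ∑ i ∈ Finset.range k, (M * 5989 + 200 * i + 142) + 100 * k =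
      k * (M * 5989 + 142) + 100 * k ^ 2 := by
    intro M k
    induction k with
    | zero => simp
    | succ k ih =>
      rw [Finset.sum_range_succ]
      nlinarith
  have := h3 (m + 2) m
  nlinarith

lemma exists_graph (m n : ℕ) (hm : 1 ≤ m) (hn : 6089 * m ^ 2 + 12020 * m + 1 ≤ n) :
    ∃ G : SimpleGraph (Fin n), distinctCycleLengths G ∧ n + 121 * m ≤ G.edgeSet.ncard + 1 := by
  obtain ⟨pad, hpad⟩ := Nat.exists_eq_add_of_le hn
  have hc := card_LL m pad hm
  obtain ⟨G, hG, he⟩ := finite_graph (PP m) (LL m pad) (PP_distinct m) last_last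
    (by
      intro i c (h : lF c = 0)
      have h' : ¬ (i = 0 ∧ c = 199) := by
        rintro ⟨_, rfl⟩
        exact last_last h
      simp only [LL, alpha, beta, PP, if_pos h, if_neg h']
      ring)
    (by
      intro i c
      simp only [LL, alpha, beta, PP]
      split_ifs with h1 h2 h2
      · exact absurd h1 (by rw [h2.2]; exact last_last)
      · have := (PP m).rpos i c
        simp only [PP] at this
        nlinarith
      · nlinarith
      · nlinarith) n (by omega)
  refine ⟨G, hG, ?_⟩
  have h1 : (PP m).T = 200 := rfl
  have h2 : (PP m).m = m := rfl
  have h3 : ((Finset.range (PP m).T).filter fun c => (PP m).lst c ≠ 0).card = 79 := card_last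
  rw [h3, h1, h2] at he
  omega

lemma le_f {n : ℕ} (G : SimpleGraph (Fin n)) (hG : distinctCycleLengths G) :
    G.edgeSet.ncard ≤ f n := by
  apply le_csSup
  · refine ⟨(Set.univ : Set (Sym2 (Fin n))).ncard, ?_⟩
    rintro e ⟨H, _, rfl⟩
    exact Set.ncard_le_ncard (Set.subset_univ _) (Set.toFinite _)
  · exact ⟨G, hG, rfl⟩

end Caterpillar

theorem stmt7 (r t n : ℕ) (hr : 1 ≤ r) (ht : t = 1260 * r + 169)
    (hn : (1309 : ℚ) / 2 * t ^ 2 - 1349159 / 6 * t + 6932215 / 3 ≤ (n : ℚ)) :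
    (n : ℚ) + 119 / 3 * t - 26399 / 3 ≤ (f n : ℚ) := by
  obtain ⟨m, hm1, hm2, hm3⟩ : ∃ m : ℕ, 1 ≤ m ∧ 49980 * r ≤ 121 * m + 2095 ∧
      121 * m + 1975 ≤ 49980 * r :=
    ⟨(49980 * r - 1975) / 121, by omega, by omega, by omega⟩
  have hmn : 6089 * m ^ 2 + 12020 * m + 1 ≤ n := by
    have h1 : (121 : ℚ) * m + 1975 ≤ 49980 * r := by exact_mod_cast hm3
    have h2 : (1 : ℚ) ≤ r := by exact_mod_cast hr
    have h3 : (0 : ℚ) ≤ m := by positivity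
    have h4 : ((6089 * m ^ 2 + 12020 * m + 1 : ℕ) : ℚ) ≤ n := by
      refine le_trans ?_ hn
      rw [ht]
      push_cast
      have h5 : (m : ℚ) ≤ (49980 * r - 1975) / 121 := by linarith
      have h6 : (m : ℚ) ^ 2 ≤ ((49980 * r - 1975) / 121) ^ 2 := pow_le_pow_left₀ h3 h5 2
      nlinarith
    exact_mod_cast h4
  obtain ⟨G, hG, he⟩ := Caterpillar.exists_graph m n hm1 hmn
  have hf := Caterpillar.le_f G hG
  have hfin : n + 49980 * r ≤ f n + 2096 := by omega
  have hq : (n : ℚ) + 49980 * r ≤ f n + 2096 := by exact_mod_cast hfin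
  rw [ht]
  push_cast
  linarith
end
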